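/- arXiv:1701.08562 — 5 statements merged into one kernel-verified Lean document; each statement's English description precedes it below -/
import Mathlib

section
/- Let T ⊂ ℝ² be a triangle, t ∈ ℕ₀, and let C₁,C₂ ∈ 𝔽₂^{ℕ×ℕ} be upper triangular matrices (entries (C_j)_{kl} = 0 for k > l) generating a digital (t,2)-sequence over 𝔽₂, and let the points in T be p_h := φ^{(ν(h))}(X(h)) for h ∈ ℕ₀. Then there exists a constant C > 0 such that for every twice continuously differentiable f : T → ℝ and every positive integer m, |(1/2^m)·∑_{h=0}^{2^m−1} f(p_h) − (1/|T|)·∫_T f(x) dx| ≤ C·‖f‖_{C²(T)}·m²/2^m. -/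
open MeasureTheory

noncomputable section

/-- The two-element field. -/
abbrev F2 : Type := ZMod 2

/-- Points of the plane. -/
abbrev Pt : Type := EuclideanSpace ℝ (Fin 2)

/-- The (closed) triangle with vertices `A`, `B`, `C`. -/
def tri (A B C : Pt) : Set Pt :=
  {x | ∃ w1 w2 w3 : ℝ, 0 ≤ w1 ∧ 0 ≤ w2 ∧ 0 ≤ w3 ∧ w1 + w2 + w3 = 1 ∧
    x = w1 • A + w2 • B + w3 • C}

/-- One step of the recursive partitioning, acting on vertex triples `(A,B,C)`. -/
def subV (v : Pt × Pt × Pt) (ξ : F2 × F2) : Pt × Pt × Pt :=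
  if ξ = (1, 0) then (v.1, (2:ℝ)⁻¹ • (v.1 + v.2.1), (2:ℝ)⁻¹ • (v.1 + v.2.2))
  else if ξ = (0, 1) then ((2:ℝ)⁻¹ • (v.2.1 + v.1), v.2.1, (2:ℝ)⁻¹ • (v.2.1 + v.2.2))
  else if ξ = (1, 1) then ((2:ℝ)⁻¹ • (v.2.2 + v.1), (2:ℝ)⁻¹ • (v.2.2 + v.2.1), v.2.2)
  else ((2:ℝ)⁻¹ • (v.2.1 + v.2.2), (2:ℝ)⁻¹ • (v.2.2 + v.1), (2:ℝ)⁻¹ • (v.1 + v.2.1))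

/-- Iterated partitioning along a list of pairs of bits (the rows of `X`). -/
def vIter (v : Pt × Pt × Pt) (l : List (F2 × F2)) : Pt × Pt × Pt := l.foldl subV v

/-- The subtriangle `T^{(n)}(X)` where `l` is the list of rows of `X`. -/
def subTri (v : Pt × Pt × Pt) (l : List (F2 × F2)) : Set Pt :=
  tri (vIter v l).1 (vIter v l).2.1 (vIter v l).2.2

/-- The centre `φ^{(n)}(X)` of the subtriangle `T^{(n)}(X)`. -/
def ctr (v : Pt × Pt × Pt) (l : List (F2 × F2)) : Pt :=
  (3:ℝ)⁻¹ • ((vIter v l).1 + (vIter v l).2.1 + (vIter v l).2.2)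

/-- The sign `η_i(X)` (with `i` 1-indexed, `1 ≤ i ≤ n+1`). -/
def eta {n : ℕ} (X : Fin n → F2 × F2) (i : ℕ) : ℝ :=
  (-1 : ℝ) ^ (Finset.univ.filter fun a : Fin n => (a : ℕ) + 1 < i ∧ X a = (0, 0)).card

/-- First coordinate direction. -/
def dir1 : Pt := EuclideanSpace.single 0 1

/-- Second coordinate direction. -/
def dir2 : Pt := EuclideanSpace.single 1 1

/-- Partial derivative (within `T`) of `f` in the direction `v`. -/
def pdW (T : Set Pt) (v : Pt) (f : Pt → ℝ) : Pt → ℝ := fun x => fderivWithin ℝ f T x v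

/-- Sup of `|g|` over `T`. -/
def supAbs (T : Set Pt) (g : Pt → ℝ) : ℝ := ⨆ x ∈ T, |g x|

/-- The norm `‖f‖_{C²(T)}`: the maximum over all partial derivatives of order at most 2
of the sup norm on `T`. -/
def c2Norm (T : Set Pt) (f : Pt → ℝ) : ℝ :=
  max (supAbs T f)
    (max (max (supAbs T (pdW T dir1 f)) (supAbs T (pdW T dir2 f)))
      (max (supAbs T (pdW T dir1 (pdW T dir1 f)))
        (max (supAbs T (pdW T dir2 (pdW T dir1 f)))
          (supAbs T (pdW T dir2 (pdW T dir2 f))))))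

/-- The `n`-th discretized function `F_n` of `f` (with `X` given by its rows). -/
def discF (v : Pt × Pt × Pt) {n : ℕ} (f : Pt → ℝ) (X : Fin n → F2 × F2) : ℝ :=
  (volume (subTri v (List.ofFn X))).toReal⁻¹ * ∫ y in subTri v (List.ofFn X), f y

/-- The `l`-th dyadic digit of `h`. -/
def digit (h l : ℕ) : F2 := if Nat.testBit h l then 1 else 0

/-- The weight `μ₁(k)` of a column vector: the largest (1-indexed) position of a
nonzero entry, and `0` for the zero vector. -/
def mu1 {n : ℕ} (k : Fin n → F2) : ℕ :=
  (Finset.univ.filter fun i : Fin n => k i ≠ 0).sup fun i => (i : ℕ) + 1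

/-- The weight `v(K) = max (μ₁(k₁), μ₁(k₂))` of `K` (given by its rows). -/
def vK {n : ℕ} (K : Fin n → F2 × F2) : ℕ :=
  max (mu1 fun i => (K i).1) (mu1 fun i => (K i).2)

/-- Entry `(i, j)` (0-indexed row `i`) of the point `X(h)` of the digital sequence with
generating matrices `Cm 0`, `Cm 1` (0-indexed). -/
def Xent (Cm : Fin 2 → ℕ → ℕ → F2) (h i : ℕ) (j : Fin 2) : F2 :=
  ∑ l ∈ Finset.range (h + 1), Cm j i l * digit h l

/-- Row `i` (0-indexed) of the point `X(h)` of the digital sequence. -/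
def XrowS (Cm : Fin 2 → ℕ → ℕ → F2) (h i : ℕ) : F2 × F2 :=
  (Xent Cm h i 0, Xent Cm h i 1)

/-- `ν(h)`: the number of initial rows of `X(h)` after which all rows vanish. -/
def nuF (Cm : Fin 2 → ℕ → ℕ → F2) (h : ℕ) : ℕ :=
  sInf {q | ∀ i, q ≤ i → XrowS Cm h i = (0, 0)}

/-- The `h`-th point of the sequence `S_T` in the triangle with vertex triple `v`. -/
def seqPt (v : Pt × Pt × Pt) (Cm : Fin 2 → ℕ → ℕ → F2) (h : ℕ) : Pt :=
  ctr v (List.ofFn fun i : Fin (nuF Cm h) => XrowS Cm h (i : ℕ))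

/-- Row `i` of the digital-net point `X(h)` for generating matrices `C1 C2 ∈ 𝔽₂^{n×m}`. -/
def XnetRow {n m : ℕ} (C1 C2 : Matrix (Fin n) (Fin m) F2) (h : ℕ) (i : Fin n) : F2 × F2 :=
  (∑ l : Fin m, C1 i l * digit h (l : ℕ), ∑ l : Fin m, C2 i l * digit h (l : ℕ))

/-- The Walsh function `wal_K(X)` (for `K`, `X` given by their rows). -/
def walR {n : ℕ} (K X : Fin n → F2 × F2) : ℝ :=
  (-1 : ℝ) ^ (∑ i : Fin n, ((K i).1 * (X i).1 + (K i).2 * (X i).2)).val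

/-- The `K`-th Walsh coefficient of `F : 𝔽₂^{n×2} → ℝ`. -/
def fhat {n : ℕ} (F : (Fin n → F2 × F2) → ℝ) (K : Fin n → F2 × F2) : ℝ :=
  ((4:ℝ) ^ n)⁻¹ * ∑ X : Fin n → F2 × F2, F X * walR K X

/-- The vector `τ(κ, κ')`. -/
def tau (e : F2 × F2 → Pt) (κ κ' : F2 × F2) : Pt :=
  if κ' ≠ (0, 0) ∧ κ' ≠ κ then e (κ + κ') - e κ' else e (κ + κ') + e κ'

/-- The point shift `y ⊕_i κ` on `T^{(n)}(X)` (with `i : Fin n` the 0-indexed row,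
corresponding to the 1-indexed row `i+1` of the paper). -/
def ptShift (e : F2 × F2 → Pt) {n : ℕ} (X : Fin n → F2 × F2) (i : Fin n)
    (κ : F2 × F2) (y : Pt) : Pt :=
  if X i ≠ (0, 0) ∧ X i ≠ κ then
    y + (eta X ((i : ℕ) + 1) / 2 ^ ((i : ℕ) + 1)) • tau e κ (X i)
  else
    (2:ℝ) • ctr (e (1, 0), e (0, 1), e (1, 1)) ((List.ofFn X).take (i : ℕ)) - y +
      (eta X ((i : ℕ) + 1) / 2 ^ ((i : ℕ) + 1)) • tau e κ (X i)

/-- The map `σ : 𝔽₂² → 𝔽₂²`. -/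
def sigF : F2 × F2 → F2 × F2 := fun κ =>
  if κ = (0, 0) then (1, 1) else if κ = (1, 1) then (0, 1) else κ

/-- The two-element set `P(κ) = {p₁(κ), p₂(κ)}`. -/
def pSet (κ : F2 × F2) : Finset (F2 × F2) :=
  if κ = (0, 0) then {(0, 0), (1, 1)} else if κ = (0, 1) then {(1, 1), (1, 0)}
  else if κ = (1, 0) then {(1, 1), (0, 1)} else {(1, 0), (1, 1)}

/-- The one-row Walsh function `wal_κ(ξ)`. -/
def walRow (κ ξ : F2 × F2) : ℝ := (-1 : ℝ) ^ ((κ.1 * ξ.1 + κ.2 * ξ.2 : F2)).val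

/-- The `i`-th dyadic difference `d_K^{(i)} F` (with `i : Fin n` 0-indexed, corresponding
to the 1-indexed index `i+1` of the paper). -/
def dd {n : ℕ} (K : Fin n → F2 × F2) (i : Fin n) (F : (Fin n → F2 × F2) → ℝ) :
    (Fin n → F2 × F2) → ℝ :=
  fun X => F (Function.update X i (X i + sigF (K i))) + walRow (K i) (sigF (K i)) * F X

/-- The subset `R_w(K) ⊆ 𝔽₂^{n×2}` (here `w : ℕ` is the 1-indexed paper index,
`0 ≤ w ≤ v(K)-1`). -/
def Rset {n : ℕ} (K : Fin n → F2 × F2) (w : ℕ) : Finset (Fin n → F2 × F2) :=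
  Finset.univ.filter fun X =>
    (∀ i : Fin n, w ≤ (i : ℕ) → (i : ℕ) + 1 < vK K → X i ∉ pSet (K i)) ∧
    (w = 0 ∨ ∃ j : Fin n, (j : ℕ) + 1 = w ∧ X j ∈ pSet (K j))

/-- The Walsh coefficient of `F` on the subset `R_w(K)`. -/
def rwHat {n : ℕ} (F : (Fin n → F2 × F2) → ℝ) (K : Fin n → F2 × F2) (w : ℕ) : ℝ :=
  ((4:ℝ) ^ n)⁻¹ * ∑ X ∈ Rset K w, F X * walR K X

/-- The nontrivial additive character of the two-element field. -/
def chi (x : F2) : ℝ := (-1 : ℝ) ^ x.val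

lemma F2_cases (x : F2) : x = 0 ∨ x = 1 := by
  revert x; decide

lemma chi_zero : chi 0 = 1 := by simp [chi]

lemma chi_one : chi 1 = -1 := by simp [chi, ZMod.val_one]

lemma chi_add (x y : F2) : chi (x + y) = chi x * chi y := by
  have h : (1 : F2) + 1 = 0 := by decide
  rcases F2_cases x with rfl | rfl <;> rcases F2_cases y with rfl | rfl <;>
    simp [chi_zero, chi_one, h]

lemma abs_chi (x : F2) : |chi x| = 1 := by
  rcases F2_cases x with rfl | rfl <;> simp [chi_zero, chi_one]

lemma chi_sum {ι : Type*} (s : Finset ι) (x : ι → F2) :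
    chi (∑ i ∈ s, x i) = ∏ i ∈ s, chi (x i) := by
  classical
  induction s using Finset.induction_on with
  | empty => simp [chi_zero]
  | insert a s ha ih => rw [Finset.sum_insert ha, Finset.prod_insert ha, chi_add, ih]

lemma walRow_eq (κ ξ : F2 × F2) : walRow κ ξ = chi (κ.1 * ξ.1 + κ.2 * ξ.2) := rfl

lemma abs_walRow (κ ξ : F2 × F2) : |walRow κ ξ| = 1 := abs_chi _

lemma walR_eq_prod {n : ℕ} (K X : Fin n → F2 × F2) :
    walR K X = ∏ i, walRow (K i) (X i) :=
  chi_sum _ _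

lemma sum_F2_prod {M : Type*} [AddCommMonoid M] (a : F2 × F2 → M) :
    ∑ ξ, a ξ = a (0, 0) + a (0, 1) + a (1, 0) + a (1, 1) := by
  have h : ∀ b : F2 → M, ∑ x, b x = b 0 + b 1 := fun b => Fin.sum_univ_two b
  rw [Fintype.sum_prod_type, h, h, h, add_assoc, add_assoc, add_assoc]

lemma walRow_zero_left (ξ : F2 × F2) : walRow 0 ξ = 1 := by
  simp [walRow_eq, chi_zero]

lemma sum_walRow_left (ξ : F2 × F2) : ∑ κ, walRow κ ξ = if ξ = 0 then 4 else 0 := by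
  obtain ⟨x, y⟩ := ξ
  rw [sum_F2_prod]
  rcases F2_cases x with rfl | rfl <;> rcases F2_cases y with rfl | rfl <;>
    norm_num [walRow_eq, chi_zero, chi_one, Prod.ext_iff, show chi 2 = 1 from chi_zero]

lemma sum_walRow_right {κ : F2 × F2} (hκ : κ ≠ 0) : ∑ ξ, walRow κ ξ = 0 := by
  have h := sum_walRow_left κ
  rw [if_neg hκ] at h
  rw [← h]
  simp only [walRow_eq, mul_comm]

/-- Orthogonality of the Walsh functions. -/
lemma sum_walR_mul {n : ℕ} (X Y : Fin n → F2 × F2) :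
    ∑ K, walR K X * walR K Y = if X = Y then (4 : ℝ) ^ n else 0 := by
  have h1 : ∀ K : Fin n → F2 × F2,
      walR K X * walR K Y = ∏ i, walRow (K i) (X i + Y i) := by
    intro K
    rw [walR_eq_prod, walR_eq_prod, ← Finset.prod_mul_distrib]
    refine Finset.prod_congr rfl fun i _ => ?_
    rw [walRow_eq, walRow_eq, walRow_eq, ← chi_add]
    congr 1
    simp only [Prod.fst_add, Prod.snd_add]
    ring
  have h2 := Finset.prod_univ_sum (fun _ : Fin n => (Finset.univ : Finset (F2 × F2)))
    (fun i κ => walRow κ (X i + Y i))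
  rw [Fintype.piFinset_univ] at h2
  rw [Finset.sum_congr rfl fun K _ => h1 K, ← h2]
  have h3 : ∀ x y : F2 × F2, x + y = 0 ↔ x = y := by decide
  simp only [sum_walRow_left, h3]
  split_ifs with h
  · subst h; simp
  · obtain ⟨i, hi⟩ := Function.ne_iff.mp h
    exact Finset.prod_eq_zero (Finset.mem_univ i) (if_neg hi)

/-- The Walsh expansion of a function on `𝔽₂^{n×2}`. -/
lemma sum_fhat_mul_walR {n : ℕ} (F : (Fin n → F2 × F2) → ℝ) (X : Fin n → F2 × F2) :
    ∑ K, fhat F K * walR K X = F X := by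
  have h : ∀ K, fhat F K * walR K X
      = ((4 : ℝ) ^ n)⁻¹ * ∑ Y, F Y * (walR K Y * walR K X) := by
    intro K
    rw [fhat, mul_assoc, Finset.sum_mul]
    simp only [mul_assoc]
  simp only [h]
  rw [← Finset.mul_sum, Finset.sum_comm]
  simp only [← Finset.mul_sum, sum_walR_mul]
  simp only [mul_ite, mul_zero, Finset.sum_ite_eq', Finset.mem_univ, if_true]
  field_simp

lemma fhat_zero {F : (Fin 0 → F2 × F2) → ℝ} (K : Fin 0 → F2 × F2) : fhat F K = F ![] := by
  simp [fhat, walR, Subsingleton.elim default ![]]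

/-- Splitting off the first row in a Walsh coefficient. -/
lemma fhat_succ {n : ℕ} (F : (Fin (n + 1) → F2 × F2) → ℝ) (K : Fin (n + 1) → F2 × F2) :
    fhat F K = 4⁻¹ * ∑ ξ, walRow (K 0) ξ *
      fhat (fun X : Fin n → F2 × F2 => F (Fin.cons ξ X)) (Fin.tail K) := by
  have h : ∑ X, F X * walR K X = ∑ p : (F2 × F2) × (Fin n → F2 × F2),
      F (Fin.cons p.1 p.2) * walR K (Fin.cons p.1 p.2) :=
    ((Fin.consEquiv fun _ => F2 × F2).sum_comp fun X => F X * walR K X).symm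
  rw [fhat, h, Fintype.sum_prod_type, pow_succ, mul_inv, mul_comm ((4 : ℝ) ^ n)⁻¹, mul_assoc,
    Finset.mul_sum]
  congr 1
  refine Finset.sum_congr rfl fun ξ _ => ?_
  rw [fhat, mul_left_comm (walRow _ _)]
  congr 1
  rw [Finset.mul_sum]
  refine Finset.sum_congr rfl fun X _ => ?_
  rw [walR_eq_prod, walR_eq_prod, Fin.prod_univ_succ]
  simp only [Fin.cons_zero, Fin.cons_succ, Fin.tail]
  ring

/-- Summing a product over the dyadic digits of all `h < 2 ^ m`. -/
lemma sum_range_two_pow_prod (m : ℕ) (G : ℕ → F2 → ℝ) :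
    ∑ h ∈ Finset.range (2 ^ m), ∏ l ∈ Finset.range m, G l (digit h l)
      = ∏ l ∈ Finset.range m, (G l 0 + G l 1) := by
  induction m with
  | zero => simp
  | succ m ih =>
    rw [pow_succ, mul_two, Finset.sum_range_add, Finset.prod_range_succ _ m, ← ih, mul_add,
      Finset.sum_mul, Finset.sum_mul]
    congr 1
    · refine Finset.sum_congr rfl fun h hh => ?_
      rw [Finset.prod_range_succ, digit, Nat.testBit_lt_two_pow (Finset.mem_range.mp hh)]
      simp
    · refine Finset.sum_congr rfl fun h hh => ?_
      rw [Finset.prod_range_succ, digit, Nat.testBit_two_pow_add_eq,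
        Nat.testBit_lt_two_pow (Finset.mem_range.mp hh)]
      simp only [Bool.not_false, if_true]
      congr 1
      refine Finset.prod_congr rfl fun l hl => ?_
      rw [digit, digit, Nat.testBit_two_pow_add_gt (Finset.mem_range.mp hl)]

lemma digit_eq_zero {h l : ℕ} (hh : h < 2 ^ l) : digit h l = 0 := by
  rw [digit, Nat.testBit_lt_two_pow hh]; simp

/-- For `h < 2 ^ m`, only the first `m` digits enter in the entries of `X(h)`. -/
lemma Xent_eq_sum_range (Cm : Fin 2 → ℕ → ℕ → F2) {h m : ℕ} (hh : h < 2 ^ m) (i : ℕ) (j : Fin 2) :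
    Xent Cm h i j = ∑ l ∈ Finset.range m, Cm j i l * digit h l := by
  have key : ∀ q, (∀ l, q ≤ l → digit h l = 0) →
      ∑ l ∈ Finset.range q, Cm j i l * digit h l
        = ∑ l ∈ Finset.range (max (h + 1) m ⊔ q), Cm j i l * digit h l := by
    intro q hq
    refine Finset.sum_subset (Finset.range_mono le_sup_right) fun l _ hl => ?_
    rw [hq l (by simpa using hl), mul_zero]
  have h1 := key (h + 1) fun l hl =>
    digit_eq_zero (lt_of_lt_of_le (by omega) Nat.lt_two_pow_self.le)
  have h2 := key m fun l hl =>
    digit_eq_zero (hh.trans_le (Nat.pow_le_pow_right (by norm_num) hl))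
  rw [Xent, h1, h2]
  simp

/-- The column sums of `K` against the generating matrices, whose vanishing for `l < m`
characterizes membership of `K` in the dual net. -/
def dualForm (Cm : Fin 2 → ℕ → ℕ → F2) {n : ℕ} (K : Fin n → F2 × F2) (l : ℕ) : F2 :=
  ∑ i : Fin n, (Cm 0 (i : ℕ) l * (K i).1 + Cm 1 (i : ℕ) l * (K i).2)

/-- The dual net. -/
def dualNet (Cm : Fin 2 → ℕ → ℕ → F2) (n m : ℕ) : Set (Fin n → F2 × F2) :=
  {K | ∀ l < m, dualForm Cm K l = 0}

open Classical in
/-- The character property of digital nets. -/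
lemma sum_walR_net (Cm : Fin 2 → ℕ → ℕ → F2) {n : ℕ} (m : ℕ) (K : Fin n → F2 × F2) :
    ∑ h ∈ Finset.range (2 ^ m), walR K (fun i => XrowS Cm h i)
      = if K ∈ dualNet Cm n m then (2 : ℝ) ^ m else 0 := by
  have h1 : ∀ h ∈ Finset.range (2 ^ m), walR K (fun i => XrowS Cm h i)
      = ∏ l ∈ Finset.range m, chi (dualForm Cm K l * digit h l) := by
    intro h hh
    rw [← chi_sum]
    change chi _ = chi _
    congr 1
    simp only [XrowS, Xent_eq_sum_range Cm (Finset.mem_range.mp hh), dualForm, Finset.sum_mul,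
      Finset.mul_sum]
    rw [Finset.sum_comm]
    refine Finset.sum_congr rfl fun i _ => ?_
    rw [← Finset.sum_add_distrib]
    refine Finset.sum_congr rfl fun l _ => ?_
    ring
  rw [Finset.sum_congr rfl h1,
    sum_range_two_pow_prod m fun l d => chi (dualForm Cm K l * d)]
  simp only [mul_zero, mul_one, chi_zero]
  split_ifs with hK
  · rw [Finset.prod_congr rfl (g := fun _ => (2 : ℝ))]
    · simp
    · intro l hl
      rw [hK l (Finset.mem_range.mp hl), chi_zero]
      norm_num
  · simp only [dualNet, Set.mem_ofPred_eq, not_forall] at hK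
    obtain ⟨l, hl, hne⟩ := hK
    refine Finset.prod_eq_zero (Finset.mem_range.mpr hl) ?_
    rw [(F2_cases _).resolve_left hne, chi_one]
    norm_num

open Classical in
/-- The quadrature sum over a digital net is the sum of the Walsh coefficients over the
dual net. -/
lemma net_sum_eq_dual_sum (Cm : Fin 2 → ℕ → ℕ → F2) {n : ℕ} (m : ℕ)
    (F : (Fin n → F2 × F2) → ℝ) :
    ((2 : ℝ) ^ m)⁻¹ * ∑ h ∈ Finset.range (2 ^ m), F (fun i => XrowS Cm h i)
      = ∑ K with K ∈ dualNet Cm n m, fhat F K := by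
  have h : ∑ h ∈ Finset.range (2 ^ m), F (fun i => XrowS Cm h i)
      = ∑ K, fhat F K * if K ∈ dualNet Cm n m then (2 : ℝ) ^ m else 0 := by
    simp only [← sum_walR_net, Finset.mul_sum]
    rw [Finset.sum_comm]
    exact Finset.sum_congr rfl fun h _ => (sum_fhat_mul_walR F _).symm
  rw [h, Finset.mul_sum, Finset.sum_filter]
  refine Finset.sum_congr rfl fun K _ => ?_
  split_ifs
  · field_simp
  · simp

lemma mu1_le_iff {n : ℕ} {k : Fin n → F2} {a : ℕ} :
    mu1 k ≤ a ↔ ∀ i : Fin n, k i ≠ 0 → (i : ℕ) + 1 ≤ a := by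
  simp [mu1]

lemma lt_mu1 {n : ℕ} {k : Fin n → F2} {i : Fin n} (h : k i ≠ 0) : (i : ℕ) < mu1 k :=
  mu1_le_iff.mp le_rfl i h

lemma mu1_le {n : ℕ} (k : Fin n → F2) : mu1 k ≤ n :=
  mu1_le_iff.mpr fun i _ => i.2

lemma exists_eq_vK {n : ℕ} {K : Fin n → F2 × F2} (hK : K ≠ 0) :
    ∃ j : Fin n, (j : ℕ) + 1 = vK K ∧ K j ≠ 0 ∧ ∀ i, j < i → K i = 0 := by
  have hne : (Finset.univ.filter fun i : Fin n => K i ≠ 0).Nonempty := by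
    obtain ⟨i, hi⟩ := Function.ne_iff.mp hK
    exact ⟨i, by simpa using hi⟩
  set j := (Finset.univ.filter fun i : Fin n => K i ≠ 0).max' hne with hj
  have hjK : K j ≠ 0 := by simpa using Finset.max'_mem _ hne
  have hle : ∀ i, K i ≠ 0 → i ≤ j := fun i hi => Finset.le_max' _ _ (by simpa using hi)
  refine ⟨j, le_antisymm ?_ ?_, hjK, fun i hi => ?_⟩
  · by_cases h1 : (K j).1 = 0
    · have h2 : (K j).2 ≠ 0 := fun h2 => hjK (Prod.ext h1 h2)
      exact (lt_mu1 (k := fun i => (K i).2) h2).trans_le (le_max_right _ _)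
    · exact (lt_mu1 (k := fun i => (K i).1) h1).trans_le (le_max_left _ _)
  · refine max_le (mu1_le_iff.mpr fun i hi => ?_) (mu1_le_iff.mpr fun i hi => ?_)
    · exact Nat.succ_le_succ (hle i fun h => hi (by rw [h]; rfl))
    · exact Nat.succ_le_succ (hle i fun h => hi (by rw [h]; rfl))
  · by_contra h
    exact absurd (hle i h) (not_le.mpr hi)

lemma dualNet_sub (Cm : Fin 2 → ℕ → ℕ → F2) {n m : ℕ} {K K' : Fin n → F2 × F2}
    (hK : K ∈ dualNet Cm n m) (hK' : K' ∈ dualNet Cm n m) : K - K' ∈ dualNet Cm n m := by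
  intro l hl
  have h1 := hK l hl
  have h2 := hK' l hl
  have h3 : dualForm Cm (K - K') l = dualForm Cm K l - dualForm Cm K' l := by
    simp only [dualForm, Pi.sub_apply, Prod.fst_sub, Prod.snd_sub, ← Finset.sum_sub_distrib]
    exact Finset.sum_congr rfl fun i _ => by ring
  rw [h3, h1, h2, sub_zero]

open Classical in
/-- If nonzero elements of the dual net have weight larger than `p`, then few of them
have their components of prescribed weights. -/
lemma card_dual_mul_le (Cm : Fin 2 → ℕ → ℕ → F2) {n m p : ℕ}
    (hp : ∀ K ∈ dualNet Cm n m, K ≠ 0 →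
      p + 1 ≤ mu1 (fun i => (K i).1) + mu1 (fun i => (K i).2)) (a b : ℕ) :
    (Finset.univ.filter fun K : Fin n → F2 × F2 => K ∈ dualNet Cm n m ∧ K ≠ 0 ∧
      mu1 (fun i => (K i).1) = a ∧ mu1 (fun i => (K i).2) = b).card * 2 ^ p ≤ 2 ^ (a + b) := by
  set S := Finset.univ.filter fun K : Fin n → F2 × F2 => K ∈ dualNet Cm n m ∧ K ≠ 0 ∧
      mu1 (fun i => (K i).1) = a ∧ mu1 (fun i => (K i).2) = b with hS
  rcases le_or_gt (a + b) p with hab | hab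
  · have : S = ∅ := by
      refine Finset.filter_eq_empty_iff.mpr fun K _ hK => ?_
      have := hp K hK.1 hK.2.1
      rw [hK.2.2.1, hK.2.2.2] at this
      omega
    simp [this]
  obtain ⟨a', b', ha, hb, hsum⟩ : ∃ a' b', a' ≤ a ∧ b' ≤ b ∧ a' + b' = p :=
    ⟨min a p, p - min a p, min_le_left _ _, by omega, by omega⟩
  let T1 : (Fin n → F2 × F2) → (Fin (a - a') → F2) := fun K i =>
    if h : a' + i < n then (K ⟨a' + i, h⟩).1 else 0
  let T2 : (Fin n → F2 × F2) → (Fin (b - b') → F2) := fun K i =>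
    if h : b' + i < n then (K ⟨b' + i, h⟩).2 else 0
  have hinj : Set.InjOn (fun K => (T1 K, T2 K)) (S : Set (Fin n → F2 × F2)) := by
    intro K hK K' hK' hKK
    simp only [hS, Finset.coe_filter, Finset.mem_univ, true_and, Set.mem_ofPred_eq] at hK hK'
    obtain ⟨hKd, -, hKa, hKb⟩ := hK
    obtain ⟨hKd', -, hKa', hKb'⟩ := hK'
    have e1 : T1 K = T1 K' := congrArg Prod.fst hKK
    have e2 : T2 K = T2 K' := congrArg Prod.snd hKK
    by_contra hne
    have hw := hp _ (dualNet_sub Cm hKd hKd') (sub_ne_zero.mpr hne)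
    have h1 : mu1 (fun i => ((K - K') i).1) ≤ a' := by
      refine mu1_le_iff.mpr fun i hi => ?_
      by_contra hlt
      apply hi
      rcases lt_or_ge (i : ℕ) a with hia | hia
      · have := congrFun e1 ⟨i - a', by omega⟩
        have hi' : a' + ((i : ℕ) - a') = i := by omega
        simp only [T1, hi', i.2, dite_true] at this
        simp [this]
      · have z1 := mu1_le_iff.mp hKa.le i
        have z2 := mu1_le_iff.mp hKa'.le i
        have z1' : (K i).1 = 0 := by by_contra h; have := z1 h; omega
        have z2' : (K' i).1 = 0 := by by_contra h; have := z2 h; omega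
        simp [z1', z2']
    have h2 : mu1 (fun i => ((K - K') i).2) ≤ b' := by
      refine mu1_le_iff.mpr fun i hi => ?_
      by_contra hlt
      apply hi
      rcases lt_or_ge (i : ℕ) b with hib | hib
      · have := congrFun e2 ⟨i - b', by omega⟩
        have hi' : b' + ((i : ℕ) - b') = i := by omega
        simp only [T2, hi', i.2, dite_true] at this
        simp [this]
      · have z1 := mu1_le_iff.mp hKb.le i
        have z2 := mu1_le_iff.mp hKb'.le i
        have z1' : (K i).2 = 0 := by by_contra h; have := z1 h; omega
        have z2' : (K' i).2 = 0 := by by_contra h; have := z2 h; omega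
        simp [z1', z2']
    omega
  have hcard := Finset.card_le_card_of_injOn (s := S) (t := Finset.univ)
    (fun K => (T1 K, T2 K)) (fun _ _ => Finset.mem_univ _) hinj
  simp only [Finset.card_univ, Fintype.card_prod, Fintype.card_fun, Fintype.card_fin,
    ZMod.card] at hcard
  calc S.card * 2 ^ p ≤ 2 ^ (a - a') * 2 ^ (b - b') * 2 ^ p := Nat.mul_le_mul_right _ hcard
    _ = 2 ^ (a + b) := by
      rw [← pow_add, ← pow_add]; congr 1; omega

/-- Geometric sums along the off-diagonals. -/
lemma sum_four_inv_pow_max_le (n b : ℕ) :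
    ∑ a ∈ Finset.range n, (2 : ℝ) ^ (a + b) * (4⁻¹ : ℝ) ^ max a b ≤ 4 := by
  have hterm : ∀ a, (2 : ℝ) ^ (a + b) * (4⁻¹ : ℝ) ^ max a b
      ≤ (if a ≤ b then (2⁻¹ : ℝ) ^ (b - a) else 0) + (if b ≤ a then (2⁻¹ : ℝ) ^ (a - b) else 0) := by
    intro a
    have h4 : (4⁻¹ : ℝ) = 2⁻¹ * 2⁻¹ := by norm_num
    have key : ∀ x y : ℕ, (2 : ℝ) ^ (x + (x + y)) * (4⁻¹ : ℝ) ^ (x + y) = 2⁻¹ ^ y := by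
      intro x y
      rw [h4, mul_pow, pow_add (2 : ℝ), pow_add (2⁻¹ : ℝ), inv_pow, inv_pow, pow_add (2 : ℝ)]
      field_simp
    rcases le_total a b with h | h
    · obtain ⟨y, rfl⟩ := Nat.exists_eq_add_of_le h
      rw [max_eq_right h, key, if_pos h, Nat.add_sub_cancel_left]
      have : (0 : ℝ) ≤ if a + y ≤ a then (2⁻¹ : ℝ) ^ (a - (a + y)) else 0 := by positivity
      linarith
    · obtain ⟨y, rfl⟩ := Nat.exists_eq_add_of_le h
      rw [max_eq_left h, add_comm (b + y) b, key, if_pos h, Nat.add_sub_cancel_left]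
      have : (0 : ℝ) ≤ if b + y ≤ b then (2⁻¹ : ℝ) ^ (b - (b + y)) else 0 := by positivity
      linarith
  have hgeo : ∀ q : ℕ, ∑ i ∈ Finset.range q, (2⁻¹ : ℝ) ^ i ≤ 2 := by
    intro q
    have := geom_sum_eq (show (2⁻¹ : ℝ) ≠ 1 by norm_num) q
    rw [this]
    have : (0 : ℝ) < 2⁻¹ ^ q := by positivity
    rw [div_le_iff_of_neg (by norm_num)]
    linarith
  have hA : ∑ a ∈ Finset.range n, (if a ≤ b then (2⁻¹ : ℝ) ^ (b - a) else 0) ≤ 2 := by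
    rw [← Finset.sum_filter]
    calc _ ≤ ∑ a ∈ Finset.range (b + 1), (2⁻¹ : ℝ) ^ (b - a) := by
          refine Finset.sum_le_sum_of_subset_of_nonneg (fun a ha => ?_) fun _ _ _ => by positivity
          simp only [Finset.mem_filter] at ha
          simpa using Nat.lt_succ_of_le ha.2
      _ = ∑ a ∈ Finset.range (b + 1), (2⁻¹ : ℝ) ^ a := by
          rw [← Finset.sum_range_reflect]
          exact Finset.sum_congr rfl fun a ha => by
            have := Finset.mem_range.mp ha
            congr 1
            omega
      _ ≤ 2 := hgeo _
  have hB : ∑ a ∈ Finset.range n, (if b ≤ a then (2⁻¹ : ℝ) ^ (a - b) else 0) ≤ 2 := by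
    rw [← Finset.sum_filter]
    calc _ ≤ ∑ a ∈ Finset.Ico b (b + n), (2⁻¹ : ℝ) ^ (a - b) := by
          refine Finset.sum_le_sum_of_subset_of_nonneg (fun a ha => ?_) fun _ _ _ => by positivity
          simp only [Finset.mem_filter, Finset.mem_range] at ha
          simp only [Finset.mem_Ico]
          omega
      _ = ∑ a ∈ Finset.range n, (2⁻¹ : ℝ) ^ a := by
          rw [Finset.sum_Ico_eq_sum_range]
          simp
      _ ≤ 2 := hgeo _
  calc _ ≤ _ := Finset.sum_le_sum fun a _ => hterm a
    _ ≤ 4 := by rw [Finset.sum_add_distrib]; linarith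

open Classical in
/-- The sum of the weights `v(K) 4^{-v(K)}` over the nonzero elements of the dual net. -/
lemma sum_dual_weight_le (Cm : Fin 2 → ℕ → ℕ → F2) {n m p : ℕ}
    (hp : ∀ K ∈ dualNet Cm n m, K ≠ 0 →
      p + 1 ≤ mu1 (fun i => (K i).1) + mu1 (fun i => (K i).2)) :
    ∑ K : Fin n → F2 × F2 with K ∈ dualNet Cm n m ∧ K ≠ 0, (vK K : ℝ) * 4⁻¹ ^ vK K
      ≤ 4 * n * (n + 1) / 2 ^ p := by
  have hmaps : ∀ K ∈ Finset.univ.filter fun K : Fin n → F2 × F2 => K ∈ dualNet Cm n m ∧ K ≠ 0,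
      (mu1 (fun i => (K i).1), mu1 (fun i => (K i).2))
        ∈ Finset.range (n + 1) ×ˢ Finset.range (n + 1) := by
    intro K _
    simp only [Finset.mem_product, Finset.mem_range]
    exact ⟨Nat.lt_succ_of_le (mu1_le _), Nat.lt_succ_of_le (mu1_le _)⟩
  rw [← Finset.sum_fiberwise_of_maps_to hmaps, Finset.sum_product_right]
  have hinner : ∀ a b : ℕ, ∑ K ∈ (Finset.univ.filter fun K : Fin n → F2 × F2 =>
        K ∈ dualNet Cm n m ∧ K ≠ 0) with
        (mu1 (fun i => (K i).1), mu1 (fun i => (K i).2)) = (a, b), (vK K : ℝ) * 4⁻¹ ^ vK K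
      ≤ (n / 2 ^ p : ℝ) * ((2 : ℝ) ^ (a + b) * (4⁻¹ : ℝ) ^ max a b) := by
    intro a b
    have hc := card_dual_mul_le Cm hp a b
    rw [Finset.filter_filter]
    have hset : (Finset.univ.filter fun K : Fin n → F2 × F2 =>
        (K ∈ dualNet Cm n m ∧ K ≠ 0) ∧
          (mu1 (fun i => (K i).1), mu1 (fun i => (K i).2)) = (a, b))
        = Finset.univ.filter fun K : Fin n → F2 × F2 => K ∈ dualNet Cm n m ∧ K ≠ 0 ∧
          mu1 (fun i => (K i).1) = a ∧ mu1 (fun i => (K i).2) = b := by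
      ext K; simp [and_assoc]
    rw [hset]
    refine (Finset.sum_le_card_nsmul _ _ ((n : ℝ) * 4⁻¹ ^ max a b) fun K hK => ?_).trans ?_
    · simp only [Finset.mem_filter, Finset.mem_univ, true_and] at hK
      have hv : vK K = max a b := by rw [vK, hK.2.2.1, hK.2.2.2]
      have hvn : vK K ≤ n := max_le (mu1_le _) (mu1_le _)
      rw [← hv]
      gcongr
    · rw [nsmul_eq_mul]
      have hc' : ((Finset.univ.filter fun K : Fin n → F2 × F2 => K ∈ dualNet Cm n m ∧ K ≠ 0 ∧
          mu1 (fun i => (K i).1) = a ∧ mu1 (fun i => (K i).2) = b).card : ℝ) * 2 ^ p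
          ≤ 2 ^ (a + b) := by exact_mod_cast hc
      rw [← le_div_iff₀ (by positivity)] at hc'
      calc _ ≤ (2 : ℝ) ^ (a + b) / 2 ^ p * ((n : ℝ) * 4⁻¹ ^ max a b) := by gcongr
        _ = _ := by ring
  calc _ ≤ ∑ b ∈ Finset.range (n + 1), ∑ a ∈ Finset.range (n + 1),
        (n / 2 ^ p : ℝ) * ((2 : ℝ) ^ (a + b) * (4⁻¹ : ℝ) ^ max a b) :=
        Finset.sum_le_sum fun b _ => Finset.sum_le_sum fun a _ => hinner a b
    _ ≤ ∑ b ∈ Finset.range (n + 1), (n / 2 ^ p : ℝ) * 4 := by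
        refine Finset.sum_le_sum fun b _ => ?_
        rw [← Finset.mul_sum]
        gcongr
        exact sum_four_inv_pow_max_le _ _
    _ = 4 * n * (n + 1) / 2 ^ p := by
        simp only [Finset.sum_const, Finset.card_range, nsmul_eq_mul]
        push_cast
        ring

/-- The change of orientation when passing to a subtriangle: the middle one is reversed. -/
def flipSign (ξ : F2 × F2) : ℝ := if ξ = (0, 0) then -1 else 1

/-- The vertex triple of the triangle with centre `c` obtained from the one with relative
vertex positions `e` by scaling with `s`. -/
def scaledTriple (e : F2 × F2 → Pt) (c : Pt) (s : ℝ) : Pt × Pt × Pt :=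
  (c + s • e (1, 0), c + s • e (0, 1), c + s • e (1, 1))

/-- The relative positions of the centres of the four subtriangles. -/
structure IsCentred (e : F2 × F2 → Pt) : Prop where
  zero : e (0, 0) = 0
  sum_eq : e (1, 0) + e (0, 1) + e (1, 1) = 0

lemma IsCentred.sum_univ {e : F2 × F2 → Pt} (he : IsCentred e) : ∑ ξ, e ξ = 0 := by
  rw [sum_F2_prod, he.zero, zero_add, add_comm (e (0, 1)), he.sum_eq]

lemma subV_scaledTriple {e : F2 × F2 → Pt} (he : IsCentred e) (c : Pt) (s : ℝ) (ξ : F2 × F2) :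
    subV (scaledTriple e c s) ξ
      = scaledTriple e (c + (s / 2) • e ξ) (flipSign ξ * (s / 2)) := by
  have h3 : e (1, 1) = -e (1, 0) - e (0, 1) := by
    have := he.sum_eq
    rw [← sub_eq_zero, ← this]; abel
  obtain ⟨x, y⟩ := ξ
  rcases F2_cases x with rfl | rfl <;> rcases F2_cases y with rfl | rfl <;>
    simp only [subV, scaledTriple, flipSign, Prod.mk.injEq, he.zero, h3, zero_ne_one, one_ne_zero,
      and_self, and_false, and_true, if_true, if_false] <;>
    refine ⟨?_, ?_, ?_⟩ <;> module

lemma ctr_cons (v : Pt × Pt × Pt) (ξ : F2 × F2) (l : List (F2 × F2)) :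
    ctr v (ξ :: l) = ctr (subV v ξ) l := rfl

lemma ctr_scaledTriple_nil {e : F2 × F2 → Pt} (he : IsCentred e) (c : Pt) (s : ℝ) :
    ctr (scaledTriple e c s) [] = c := by
  have h3 : e (1, 1) = -e (1, 0) - e (0, 1) := by
    have := he.sum_eq
    rw [← sub_eq_zero, ← this]; abel
  simp only [ctr, vIter, List.foldl_nil, scaledTriple, h3]
  module

/-- All vertices of the scaled triangle lie in `T`. -/
def VertsIn (T : Set Pt) (e : F2 × F2 → Pt) (c : Pt) (s : ℝ) : Prop :=
  c + s • e (1, 0) ∈ T ∧ c + s • e (0, 1) ∈ T ∧ c + s • e (1, 1) ∈ T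

lemma subV_mem {T : Set Pt} (hT : Convex ℝ T) {v : Pt × Pt × Pt}
    (h : v.1 ∈ T ∧ v.2.1 ∈ T ∧ v.2.2 ∈ T) (ξ : F2 × F2) :
    (subV v ξ).1 ∈ T ∧ (subV v ξ).2.1 ∈ T ∧ (subV v ξ).2.2 ∈ T := by
  obtain ⟨h1, h2, h3⟩ := h
  have mid : ∀ {x y}, x ∈ T → y ∈ T → (2 : ℝ)⁻¹ • (x + y) ∈ T := by
    intro x y hx hy
    rw [smul_add]
    exact hT hx hy (by norm_num) (by norm_num) (by norm_num)
  unfold subV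
  split_ifs
  exacts [⟨h1, mid h1 h2, mid h1 h3⟩, ⟨mid h2 h1, h2, mid h2 h3⟩, ⟨mid h3 h1, mid h3 h2, h3⟩,
    ⟨mid h2 h3, mid h3 h1, mid h1 h2⟩]

lemma VertsIn.sub {T : Set Pt} (hT : Convex ℝ T) {e : F2 × F2 → Pt} (he : IsCentred e)
    {c : Pt} {s : ℝ} (h : VertsIn T e c s) (ξ : F2 × F2) :
    VertsIn T e (c + (s / 2) • e ξ) (flipSign ξ * (s / 2)) := by
  have := subV_mem hT (v := scaledTriple e c s) h ξ
  rwa [subV_scaledTriple he] at this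

lemma VertsIn.centre_mem {T : Set Pt} (hT : Convex ℝ T) {e : F2 × F2 → Pt} (he : IsCentred e)
    {c : Pt} {s : ℝ} (h : VertsIn T e c s) : c ∈ T := by
  obtain ⟨h1, h2, h3⟩ := h
  have h12 := hT h1 h2 (show (0 : ℝ) ≤ 2⁻¹ by norm_num) (show (0 : ℝ) ≤ 2⁻¹ by norm_num)
    (by norm_num)
  have h123 := hT h12 h3 (show (0 : ℝ) ≤ 2 / 3 by norm_num) (show (0 : ℝ) ≤ 1 / 3 by norm_num)
    (by norm_num)
  have e3 : e (1, 1) = -e (1, 0) - e (0, 1) := by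
    have := he.sum_eq
    rw [← sub_eq_zero, ← this]; abel
  rw [e3] at h123
  convert h123 using 1
  module

/-- Quantitative smoothness of `f` on `T`, with gradient `g` and constant `M`. -/
structure SmoothBound (T : Set Pt) (f : Pt → ℝ) (g : Pt → Pt →L[ℝ] ℝ) (M : ℝ) : Prop where
  nonneg : 0 ≤ M
  grad_le : ∀ x ∈ T, ∀ u, |g x u| ≤ M * ‖u‖
  grad_lip : ∀ x ∈ T, ∀ y ∈ T, ∀ u, |g y u - g x u| ≤ M * ‖y - x‖ * ‖u‖
  lip : ∀ x ∈ T, ∀ y ∈ T, |f y - f x| ≤ M * ‖y - x‖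
  taylor : ∀ x ∈ T, ∀ y ∈ T, |f y - f x - g x (y - x)| ≤ M * ‖y - x‖ ^ 2

lemma abs_quarter_sum_le {a : F2 × F2 → ℝ} {b : ℝ} (h : ∀ ξ, |a ξ| ≤ b) :
    |4⁻¹ * ∑ ξ, a ξ| ≤ b := by
  have h1 : |∑ ξ, a ξ| ≤ ∑ _ξ : F2 × F2, b :=
    (Finset.abs_sum_le_sum_abs _ _).trans (Finset.sum_le_sum fun ξ _ => h ξ)
  simp only [Finset.sum_const, Finset.card_univ, Fintype.card_prod, ZMod.card, nsmul_eq_mul] at h1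
  rw [abs_mul, abs_of_pos (show (0 : ℝ) < 4⁻¹ by norm_num)]
  push_cast at h1
  linarith

lemma flipSign_sq (ξ : F2 × F2) : flipSign ξ ^ 2 = 1 := by
  unfold flipSign; split_ifs <;> norm_num

lemma abs_flipSign (ξ : F2 × F2) : |flipSign ξ| = 1 := by
  unfold flipSign; split_ifs <;> norm_num

/-- The function on `𝔽₂^{n×2}` induced by `f`. -/
def ctrFun (e : F2 × F2 → Pt) (c : Pt) (s : ℝ) (n : ℕ) (f : Pt → ℝ) : (Fin n → F2 × F2) → ℝ :=
  fun X => f (ctr (scaledTriple e c s) (List.ofFn X))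

lemma fhat_ctrFun_zero {e : F2 × F2 → Pt} (he : IsCentred e) (c : Pt) (s : ℝ) (f : Pt → ℝ)
    (K : Fin 0 → F2 × F2) : fhat (ctrFun e c s 0 f) K = f c := by
  rw [fhat_zero, ctrFun, List.ofFn_zero, ctr_scaledTriple_nil he]

lemma fhat_ctrFun_succ {e : F2 × F2 → Pt} (he : IsCentred e) (c : Pt) (s : ℝ) (f : Pt → ℝ) {n : ℕ}
    (K : Fin (n + 1) → F2 × F2) :
    fhat (ctrFun e c s (n + 1) f) K = 4⁻¹ * ∑ ξ, walRow (K 0) ξ *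
      fhat (ctrFun e (c + (s / 2) • e ξ) (flipSign ξ * (s / 2)) n f) (Fin.tail K) := by
  rw [fhat_succ]
  congr 1
  refine Finset.sum_congr rfl fun ξ _ => ?_
  congr 2
  funext X
  rw [ctrFun, ctrFun, List.ofFn_cons, ctr_cons, subV_scaledTriple he]

lemma abs_sum_walRow_mul_flipSign {κ : F2 × F2} : |∑ ξ, walRow κ ξ * flipSign ξ| = 2 := by
  obtain ⟨x, y⟩ := κ
  rw [sum_F2_prod]
  rcases F2_cases x with rfl | rfl <;> rcases F2_cases y with rfl | rfl <;>
    norm_num [walRow_eq, chi_zero, chi_one, flipSign, show chi 2 = 1 from chi_zero]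

section

variable {T : Set Pt} (hT : Convex ℝ T) {e : F2 × F2 → Pt} (he : IsCentred e) {D : ℝ}
  (hD : ∀ ξ, ‖e ξ‖ ≤ D) {f : Pt → ℝ} {g : Pt → Pt →L[ℝ] ℝ} {M : ℝ} (hf : SmoothBound T f g M)
include hT he hD hf

lemma abs_taylor_child {c : Pt} {s : ℝ} (h : VertsIn T e c s) (ξ : F2 × F2) :
    |f (c + (s / 2) • e ξ) - f c - s / 2 * g c (e ξ)| ≤ M * D ^ 2 * s ^ 2 / 4 := by
  have h1 := hf.taylor c (h.centre_mem hT he) _ ((h.sub hT he ξ).centre_mem hT he)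
  rw [add_sub_cancel_left, map_smul, smul_eq_mul, norm_smul, Real.norm_eq_abs, mul_pow, sq_abs] at h1
  refine h1.trans ?_
  have h2 : ‖e ξ‖ ^ 2 ≤ D ^ 2 := by gcongr; exact hD ξ
  have := mul_le_mul_of_nonneg_left h2 (mul_nonneg hf.nonneg (sq_nonneg s))
  linarith

/-- The mean over the centres is close to the value at the central point. -/
lemma abs_fhat_zero_sub_le (n : ℕ) : ∀ {c : Pt} {s : ℝ}, VertsIn T e c s →
    |fhat (ctrFun e c s n f) 0 - f c| ≤ M * D ^ 2 * s ^ 2 := by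
  induction n with
  | zero =>
    intro c s _
    rw [fhat_ctrFun_zero he, sub_self, abs_zero]
    exact mul_nonneg (mul_nonneg hf.nonneg (sq_nonneg _)) (sq_nonneg _)
  | succ n ih =>
    intro c s h
    have hz : ∑ ξ, s / 2 * g c (e ξ) = 0 := by
      rw [← Finset.mul_sum, ← map_sum, he.sum_univ, map_zero, mul_zero]
    have heq : fhat (ctrFun e c s (n + 1) f) 0 - f c = 4⁻¹ * ∑ ξ,
        ((fhat (ctrFun e (c + (s / 2) • e ξ) (flipSign ξ * (s / 2)) n f) 0
            - f (c + (s / 2) • e ξ))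
          + (f (c + (s / 2) • e ξ) - f c - s / 2 * g c (e ξ))) := by
      rw [fhat_ctrFun_succ he]
      simp only [Finset.sum_add_distrib, Finset.sum_sub_distrib, hz, Pi.zero_apply,
        walRow_zero_left, one_mul, Finset.sum_const, Finset.card_univ, Fintype.card_prod,
        ZMod.card, nsmul_eq_mul]
      push_cast
      change 4⁻¹ * ∑ ξ, fhat _ (0 : Fin n → F2 × F2) - _ = _
      ring
    rw [heq]
    refine abs_quarter_sum_le fun ξ => ?_
    have h1 := ih (h.sub hT he ξ)
    have h2 := abs_taylor_child hT he hD hf h ξ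
    rw [mul_pow, flipSign_sq] at h1
    have h3 : 0 ≤ M * D ^ 2 * s ^ 2 := mul_nonneg (mul_nonneg hf.nonneg (sq_nonneg _)) (sq_nonneg _)
    calc _ ≤ _ := abs_add_le _ _
      _ ≤ _ := add_le_add h1 h2
      _ ≤ _ := by linarith

/-- First-order expansion of the Walsh coefficients with respect to the size of the triangle. -/
lemma exists_fhat_expansion (hD0 : 0 ≤ D) (n : ℕ) : ∀ (K : Fin n → F2 × F2) (j : Fin n),
    K j ≠ 0 → (∀ i, j < i → K i = 0) →
    ∃ u : Pt, ‖u‖ ≤ 2 * D * 4⁻¹ ^ ((j : ℕ) + 1) ∧ ∀ c s, VertsIn T e c s →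
      |fhat (ctrFun e c s n f) K - s * g c u|
        ≤ M * (2 * D ^ 2) * (((j : ℕ) + 1 : ℕ) * 4⁻¹ ^ ((j : ℕ) + 1)) * s ^ 2 := by
  induction n with
  | zero => intro K j; exact j.elim0
  | succ n ih =>
    intro K j
    refine Fin.cases ?_ (fun j => ?_) j
    · intro hj hK
      have htail : Fin.tail K = 0 := funext fun i => hK i.succ (Fin.succ_pos i)
      refine ⟨(8 : ℝ)⁻¹ • ∑ ξ, walRow (K 0) ξ • e ξ, ?_, fun c s h => ?_⟩
      · have h1 : ‖∑ ξ, walRow (K 0) ξ • e ξ‖ ≤ ∑ _ξ : F2 × F2, D := by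
          refine (norm_sum_le _ _).trans (Finset.sum_le_sum fun ξ _ => ?_)
          rw [norm_smul, Real.norm_eq_abs, abs_walRow, one_mul]
          exact hD ξ
        simp only [Finset.sum_const, Finset.card_univ, Fintype.card_prod, ZMod.card,
          nsmul_eq_mul] at h1
        push_cast at h1
        rw [norm_smul, Real.norm_of_nonneg (by norm_num)]
        norm_num
        linarith
      · have heq : fhat (ctrFun e c s (n + 1) f) K
            - s * g c ((8 : ℝ)⁻¹ • ∑ ξ, walRow (K 0) ξ • e ξ) = 4⁻¹ * ∑ ξ, walRow (K 0) ξ *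
            ((fhat (ctrFun e (c + (s / 2) • e ξ) (flipSign ξ * (s / 2)) n f) 0
              - f (c + (s / 2) • e ξ))
            + (f (c + (s / 2) • e ξ) - f c - s / 2 * g c (e ξ))) := by
          have hw : ∑ ξ, walRow (K 0) ξ * f c = 0 := by
            rw [← Finset.sum_mul, sum_walRow_right hj, zero_mul]
          rw [fhat_ctrFun_succ he, htail]
          simp only [map_smul, map_sum, smul_eq_mul, mul_add, mul_sub, Finset.sum_add_distrib,
            Finset.sum_sub_distrib, hw, Finset.mul_sum]
          have : ∀ ξ, (4 : ℝ)⁻¹ * (walRow (K 0) ξ * (s / 2 * g c (e ξ)))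
              = s * (8⁻¹ * (walRow (K 0) ξ * g c (e ξ))) := fun ξ => by ring
          simp only [this]
          ring
        rw [heq]
        refine abs_quarter_sum_le fun ξ => ?_
        rw [abs_mul, abs_walRow, one_mul]
        have h1 := abs_fhat_zero_sub_le hT he hD hf n (h.sub hT he ξ)
        have h2 := abs_taylor_child hT he hD hf h ξ
        rw [mul_pow, flipSign_sq] at h1
        refine (abs_add_le _ _).trans ((add_le_add h1 h2).trans (le_of_eq ?_))
        norm_num
        ring
    · intro hj hK
      obtain ⟨u, hu, hexp⟩ := ih (Fin.tail K) j hj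
        fun i hi => hK i.succ (Fin.succ_lt_succ_iff.mpr hi)
      have hS := abs_sum_walRow_mul_flipSign (κ := K 0)
      set S := ∑ ξ, walRow (K 0) ξ * flipSign ξ with hSdef
      refine ⟨(S / 8) • u, ?_, fun c s h => ?_⟩
      · rw [norm_smul, Real.norm_eq_abs, abs_div, hS, Fin.val_succ, pow_succ]
        norm_num at hu ⊢
        linarith
      · have heq : fhat (ctrFun e c s (n + 1) f) K - s * g c ((S / 8) • u)
            = 4⁻¹ * ∑ ξ, walRow (K 0) ξ *
            ((fhat (ctrFun e (c + (s / 2) • e ξ) (flipSign ξ * (s / 2)) n f) (Fin.tail K)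
              - flipSign ξ * (s / 2) * g (c + (s / 2) • e ξ) u)
            + flipSign ξ * (s / 2) * (g (c + (s / 2) • e ξ) u - g c u)) := by
          rw [fhat_ctrFun_succ he, map_smul, smul_eq_mul, hSdef]
          have : s * ((∑ ξ, walRow (K 0) ξ * flipSign ξ) / 8 * g c u)
              = 4⁻¹ * ∑ ξ, walRow (K 0) ξ * (flipSign ξ * (s / 2) * g c u) := by
            rw [div_mul_eq_mul_div, Finset.sum_mul, Finset.sum_div, Finset.mul_sum, Finset.mul_sum]
            exact Finset.sum_congr rfl fun ξ _ => by ring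
          rw [this, ← mul_sub, ← Finset.sum_sub_distrib]
          congr 1
          exact Finset.sum_congr rfl fun ξ _ => by ring
        rw [heq]
        refine abs_quarter_sum_le fun ξ => ?_
        rw [abs_mul, abs_walRow, one_mul]
        have h1 := hexp _ _ (h.sub hT he ξ)
        have h2 := hf.grad_lip c (h.centre_mem hT he) _ ((h.sub hT he ξ).centre_mem hT he) u
        rw [add_sub_cancel_left, norm_smul, Real.norm_eq_abs] at h2
        rw [mul_pow, flipSign_sq] at h1
        have h3 : |flipSign ξ * (s / 2) * (g (c + (s / 2) • e ξ) u - g c u)|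
            ≤ M * (2 * D ^ 2) * 4⁻¹ ^ ((j : ℕ) + 1) * (s ^ 2 / 4) := by
          rw [abs_mul, abs_mul, abs_flipSign, one_mul]
          calc _ ≤ |s / 2| * (M * (|s / 2| * D) * (2 * D * 4⁻¹ ^ ((j : ℕ) + 1))) := by
                have := hf.nonneg
                have := hD ξ
                refine mul_le_mul_of_nonneg_left (h2.trans ?_) (abs_nonneg _)
                gcongr
            _ = |s / 2| ^ 2 * (M * (2 * D ^ 2) * 4⁻¹ ^ ((j : ℕ) + 1)) := by ring
            _ = _ := by rw [sq_abs]; ring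
        refine (abs_add_le _ _).trans ((add_le_add h1 h3).trans (le_of_eq ?_))
        rw [Fin.val_succ, pow_succ _ ((j : ℕ) + 1)]
        push_cast
        ring

/-- Decay of the Walsh coefficients of a smooth function. -/
lemma abs_fhat_le (hD0 : 0 ≤ D) {n : ℕ} {K : Fin n → F2 × F2} (hK : K ≠ 0) {c : Pt}
    (h : VertsIn T e c 1) :
    |fhat (ctrFun e c 1 n f) K| ≤ M * (2 * D + 2 * D ^ 2) * (vK K * 4⁻¹ ^ vK K) := by
  obtain ⟨j, hj, hKj, hzero⟩ := exists_eq_vK hK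
  obtain ⟨u, hu, hexp⟩ := exists_fhat_expansion hT he hD hf hD0 n K j hKj hzero
  have h1 := hexp c 1 h
  rw [hj] at h1 hu
  have hM := hf.nonneg
  have h2 : |g c u| ≤ M * (2 * D * (vK K * 4⁻¹ ^ vK K)) := by
    refine (hf.grad_le c (h.centre_mem hT he) u).trans
      (mul_le_mul_of_nonneg_left (hu.trans ?_) hM)
    refine mul_le_mul_of_nonneg_left (le_mul_of_one_le_left (by positivity) ?_) (by positivity)
    exact_mod_cast (by omega : 1 ≤ vK K)
  rw [one_mul, one_pow, mul_one] at h1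
  have h3 : fhat (ctrFun e c 1 n f) K = (fhat (ctrFun e c 1 n f) K - g c u) + g c u := by ring
  rw [h3]
  refine (abs_add_le _ _).trans ((add_le_add h1 h2).trans (le_of_eq ?_))
  ring

open Classical in
/-- The error of a digital net against the mean over all the centres. -/
lemma abs_net_sub_mean_le (hD0 : 0 ≤ D) (Cm : Fin 2 → ℕ → ℕ → F2) {n m p : ℕ}
    (hp : ∀ K ∈ dualNet Cm n m, K ≠ 0 →
      p + 1 ≤ mu1 (fun i => (K i).1) + mu1 (fun i => (K i).2)) {c : Pt} (h : VertsIn T e c 1) :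
    |((2 : ℝ) ^ m)⁻¹ * ∑ h ∈ Finset.range (2 ^ m), ctrFun e c 1 n f (fun i => XrowS Cm h i)
      - fhat (ctrFun e c 1 n f) 0| ≤ M * (2 * D + 2 * D ^ 2) * (4 * n * (n + 1) / 2 ^ p) := by
  have hmem : (0 : Fin n → F2 × F2) ∈ Finset.univ.filter fun K => K ∈ dualNet Cm n m := by
    refine Finset.mem_filter.mpr ⟨Finset.mem_univ _, fun l _ => ?_⟩
    simp [dualForm]
  rw [net_sum_eq_dual_sum, ← Finset.sum_erase_eq_sub hmem]
  have hset : (Finset.univ.filter fun K => K ∈ dualNet Cm n m).erase (0 : Fin n → F2 × F2)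
      = Finset.univ.filter fun K => K ∈ dualNet Cm n m ∧ K ≠ 0 := by
    ext K; simp [and_comm]
  rw [hset]
  calc _ ≤ ∑ K : Fin n → F2 × F2 with K ∈ dualNet Cm n m ∧ K ≠ 0,
        M * (2 * D + 2 * D ^ 2) * (vK K * 4⁻¹ ^ vK K) := by
        refine (Finset.abs_sum_le_sum_abs _ _).trans (Finset.sum_le_sum fun K hK => ?_)
        exact abs_fhat_le hT he hD hf hD0 (Finset.mem_filter.mp hK).2.2 h
    _ ≤ _ := by
        rw [← Finset.mul_sum]
        have hM := hf.nonneg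
        exact mul_le_mul_of_nonneg_left (sum_dual_weight_le Cm hp) (by positivity)

end

lemma vIter_concat (v : Pt × Pt × Pt) (l : List (F2 × F2)) (ξ : F2 × F2) :
    vIter v (l ++ [ξ]) = subV (vIter v l) ξ := by
  simp [vIter]

/-- Passing to the middle subtriangle does not change the centre. -/
lemma ctr_concat_zero (v : Pt × Pt × Pt) (l : List (F2 × F2)) :
    ctr v (l ++ [(0, 0)]) = ctr v l := by
  simp only [ctr, vIter_concat, subV, Prod.mk.injEq, zero_ne_one, and_false, and_true, if_false]
  module

lemma ctr_ofFn_eq_of_le (v : Pt × Pt × Pt) (X : ℕ → F2 × F2) {q : ℕ}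
    (hX : ∀ i, q ≤ i → X i = (0, 0)) {m : ℕ} (hm : q ≤ m) :
    ctr v (List.ofFn fun i : Fin m => X i) = ctr v (List.ofFn fun i : Fin q => X i) := by
  induction m, hm using Nat.le_induction with
  | base => rfl
  | succ m hm ih =>
    rw [List.ofFn_succ', List.concat_eq_append, Fin.val_last, hX m hm, ctr_concat_zero]
    exact ih

/-- For upper triangular generating matrices, the first `2 ^ m` points of the sequence form a
digital net with `m` rows. -/
lemma seqPt_eq (v : Pt × Pt × Pt) {Cm : Fin 2 → ℕ → ℕ → F2}
    (htri : ∀ j : Fin 2, ∀ k l : ℕ, l < k → Cm j k l = 0) {h m : ℕ} (hh : h < 2 ^ m) :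
    seqPt v Cm h = ctr v (List.ofFn fun i : Fin m => XrowS Cm h i) := by
  have hent : ∀ i j, m ≤ i → Xent Cm h i j = 0 := by
    intro i j hi
    rw [Xent_eq_sum_range Cm hh]
    refine Finset.sum_eq_zero fun l hl => ?_
    rw [htri j i l (by have := Finset.mem_range.mp hl; omega), zero_mul]
  have hm : m ∈ {q | ∀ i, q ≤ i → XrowS Cm h i = (0, 0)} := fun i hi => by
    rw [XrowS, hent i 0 hi, hent i 1 hi]
  exact (ctr_ofFn_eq_of_le v (XrowS Cm h) (Nat.sInf_mem ⟨m, hm⟩) (Nat.sInf_le hm)).symm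

/-- The triangle with a given triple of vertices. -/
def triV (v : Pt × Pt × Pt) : Set Pt := tri v.1 v.2.1 v.2.2

lemma mem_tri_fst (A B C : Pt) : A ∈ tri A B C := ⟨1, 0, 0, by simp⟩

lemma mem_tri_snd (A B C : Pt) : B ∈ tri A B C := ⟨0, 1, 0, by simp⟩

lemma mem_tri_thd (A B C : Pt) : C ∈ tri A B C := ⟨0, 0, 1, by simp⟩

lemma convex_tri (A B C : Pt) : Convex ℝ (tri A B C) := by
  rintro _ ⟨u1, u2, u3, h1, h2, h3, hu, rfl⟩ _ ⟨w1, w2, w3, k1, k2, k3, hw, rfl⟩ a b ha hb hab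
  refine ⟨a * u1 + b * w1, a * u2 + b * w2, a * u3 + b * w3, by positivity, by positivity,
    by positivity, ?_, by module⟩
  linear_combination a * hu + b * hw + hab

lemma tri_subset {T : Set Pt} (hT : Convex ℝ T) {A B C : Pt} (hA : A ∈ T) (hB : B ∈ T)
    (hC : C ∈ T) : tri A B C ⊆ T := by
  rintro _ ⟨w1, w2, w3, h1, h2, h3, hw, rfl⟩
  have := hT.sum_mem (t := Finset.univ) (w := ![w1, w2, w3]) (z := ![A, B, C])
    (by intro i _; fin_cases i <;> simpa) (by simpa [Fin.sum_univ_three] using hw)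
    (by intro i _; fin_cases i <;> simpa)
  simpa [Fin.sum_univ_three] using this

lemma tri_eq_convexHull (A B C : Pt) : tri A B C = convexHull ℝ (Set.range ![A, B, C]) := by
  refine Set.Subset.antisymm (tri_subset (convex_convexHull _ _) ?_ ?_ ?_)
    (convexHull_min ?_ (convex_tri A B C))
  · exact subset_convexHull _ _ ⟨0, rfl⟩
  · exact subset_convexHull _ _ ⟨1, rfl⟩
  · exact subset_convexHull _ _ ⟨2, rfl⟩
  · rintro _ ⟨i, rfl⟩
    fin_cases i
    exacts [mem_tri_fst A B C, mem_tri_snd A B C, mem_tri_thd A B C]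

lemma isCompact_tri (A B C : Pt) : IsCompact (tri A B C) := by
  rw [tri_eq_convexHull]
  exact (Set.finite_range _).isCompact_convexHull ℝ

lemma interior_tri_nonempty {A B C : Pt} (h : AffineIndependent ℝ ![A, B, C]) :
    (interior (tri A B C)).Nonempty := by
  rw [tri_eq_convexHull, interior_convexHull_nonempty_iff_affineSpan_eq_top]
  exact h.affineSpan_eq_top_iff_card_eq_finrank_add_one.mpr (by simp)

lemma triV_subV_subset (v : Pt × Pt × Pt) (ξ : F2 × F2) : triV (subV v ξ) ⊆ triV v := by
  have h := subV_mem (convex_tri v.1 v.2.1 v.2.2)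
    ⟨mem_tri_fst _ _ _, mem_tri_snd _ _ _, mem_tri_thd _ _ _⟩ ξ
  exact tri_subset (convex_tri _ _ _) h.1 h.2.1 h.2.2

/-- The four subtriangles cover the triangle. -/
lemma triV_subset_iUnion (v : Pt × Pt × Pt) : triV v ⊆ ⋃ ξ, triV (subV v ξ) := by
  rintro _ ⟨w1, w2, w3, h1, h2, h3, hw, rfl⟩
  rw [Set.mem_iUnion]
  by_cases k1 : 2⁻¹ ≤ w1
  · refine ⟨(1, 0), 2 * w1 - 1, 2 * w2, 2 * w3, by linarith, by linarith, by linarith,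
      by linarith, ?_⟩
    obtain rfl : w1 = 1 - w2 - w3 := by linarith
    simp only [subV, if_true]
    module
  by_cases k2 : 2⁻¹ ≤ w2
  · refine ⟨(0, 1), 2 * w1, 2 * w2 - 1, 2 * w3, by linarith, by linarith, by linarith,
      by linarith, ?_⟩
    obtain rfl : w2 = 1 - w1 - w3 := by linarith
    simp only [subV, Prod.mk.injEq, zero_ne_one, one_ne_zero, and_self, if_true, if_false]
    module
  by_cases k3 : 2⁻¹ ≤ w3
  · refine ⟨(1, 1), 2 * w1, 2 * w2, 2 * w3 - 1, by linarith, by linarith, by linarith,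
      by linarith, ?_⟩
    obtain rfl : w3 = 1 - w1 - w2 := by linarith
    simp only [subV, Prod.mk.injEq, one_ne_zero, and_false, false_and, if_true, if_false]
    module
  · refine ⟨(0, 0), 1 - 2 * w1, 1 - 2 * w2, 1 - 2 * w3, by linarith, by linarith, by linarith,
      by linarith, ?_⟩
    obtain rfl : w3 = 1 - w1 - w2 := by linarith
    simp only [subV, Prod.mk.injEq, zero_ne_one, and_false, and_true, if_false]
    module

open scoped Pointwise in
lemma triV_scaledTriple (e : F2 × F2 → Pt) (c : Pt) (s : ℝ) :
    triV (scaledTriple e c s) = Set.image (c + ·) (s • triV (scaledTriple e 0 1)) := by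
  ext x
  simp only [Set.mem_image, Set.mem_smul_set, triV, scaledTriple]
  constructor
  · rintro ⟨w1, w2, w3, h1, h2, h3, hw, rfl⟩
    refine ⟨_, ⟨_, ⟨w1, w2, w3, h1, h2, h3, hw, rfl⟩, rfl⟩, ?_⟩
    obtain rfl : w3 = 1 - w1 - w2 := by linarith
    module
  · rintro ⟨_, ⟨_, ⟨w1, w2, w3, h1, h2, h3, hw, rfl⟩, rfl⟩, rfl⟩
    refine ⟨w1, w2, w3, h1, h2, h3, hw, ?_⟩
    obtain rfl : w3 = 1 - w1 - w2 := by linarith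
    module

lemma volume_triV_scaledTriple (e : F2 × F2 → Pt) (c : Pt) (s : ℝ) :
    volume (triV (scaledTriple e c s))
      = ENNReal.ofReal (s ^ 2) * volume (triV (scaledTriple e 0 1)) := by
  rw [triV_scaledTriple, Set.image_add_left, measure_preimage_add, Measure.addHaar_smul]
  simp

lemma volume_triV_ne_top (v : Pt × Pt × Pt) : volume (triV v) ≠ ⊤ :=
  (isCompact_tri _ _ _).measure_lt_top.ne

lemma volume_triV_sub {e : F2 × F2 → Pt} (c : Pt) (s : ℝ) (ξ : F2 × F2) :
    volume (triV (scaledTriple e (c + (s / 2) • e ξ) (flipSign ξ * (s / 2))))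
      = ENNReal.ofReal 4⁻¹ * volume (triV (scaledTriple e c s)) := by
  rw [volume_triV_scaledTriple, volume_triV_scaledTriple e c s, ← mul_assoc,
    ← ENNReal.ofReal_mul (by norm_num), mul_pow, flipSign_sq]
  congr 2
  ring

/-- The Lebesgue measure on a triangle is the sum of those on the subtriangles. -/
lemma restrict_triV_eq_sum {e : F2 × F2 → Pt} (he : IsCentred e) (c : Pt) (s : ℝ) :
    volume.restrict (triV (scaledTriple e c s)) = ∑ ξ, volume.restrict
      (triV (scaledTriple e (c + (s / 2) • e ξ) (flipSign ξ * (s / 2)))) := by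
  have : IsFiniteMeasure (∑ ξ, volume.restrict
      (triV (scaledTriple e (c + (s / 2) • e ξ) (flipSign ξ * (s / 2))))) := by
    constructor
    simp only [Measure.coe_finsetSum, Finset.sum_apply, Measure.restrict_apply_univ]
    exact ENNReal.sum_lt_top.mpr fun ξ _ => (volume_triV_ne_top _).lt_top
  have : IsFiniteMeasure (volume.restrict (triV (scaledTriple e c s))) :=
    ⟨by rw [Measure.restrict_apply_univ]; exact (volume_triV_ne_top _).lt_top⟩
  refine Measure.eq_of_le_of_measure_univ_eq ?_ ?_
  · refine (Measure.restrict_mono (triV_subset_iUnion _) le_rfl).trans ?_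
    refine Measure.restrict_iUnion_le.trans (le_of_eq ?_)
    simp only [subV_scaledTriple he, Measure.sum_fintype]
  · simp only [Measure.coe_finsetSum, Finset.sum_apply, Measure.restrict_apply_univ,
      volume_triV_sub, Finset.sum_const, Finset.card_univ, Fintype.card_prod, ZMod.card,
      nsmul_eq_mul]
    rw [← mul_assoc]
    convert (one_mul _).symm
    rw [← ENNReal.ofReal_natCast, ← ENNReal.ofReal_mul (by positivity)]
    norm_num

/-- The mean of `f` over a triangle. -/
def triMean (v : Pt × Pt × Pt) (f : Pt → ℝ) : ℝ :=
  (volume (triV v)).toReal⁻¹ * ∫ z in triV v, f z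

lemma triMean_eq_sum {e : F2 × F2 → Pt} (he : IsCentred e) {c : Pt} {s : ℝ} {f : Pt → ℝ}
    (hf : IntegrableOn f (triV (scaledTriple e c s))) :
    triMean (scaledTriple e c s) f = 4⁻¹ * ∑ ξ,
      triMean (scaledTriple e (c + (s / 2) • e ξ) (flipSign ξ * (s / 2))) f := by
  have hfint : ∀ ξ ∈ Finset.univ, Integrable f (volume.restrict
      (triV (scaledTriple e (c + (s / 2) • e ξ) (flipSign ξ * (s / 2))))) := by
    intro ξ _
    rw [← subV_scaledTriple he]
    exact hf.mono_set (triV_subV_subset _ _)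
  simp only [triMean]
  rw [restrict_triV_eq_sum he, integral_finsetSum_measure hfint]
  simp only [volume_triV_sub, ENNReal.toReal_mul, ENNReal.toReal_ofReal (show (0 : ℝ) ≤ 4⁻¹ by norm_num)]
  rw [← Finset.mul_sum, ← mul_assoc]
  congr 1
  rw [mul_inv, ← mul_assoc]
  norm_num

lemma abs_triMean_sub_le {v : Pt × Pt × Pt} (hv : volume (triV v) ≠ 0) {f : Pt → ℝ} {a b : ℝ}
    (hf : IntegrableOn f (triV v)) (h : ∀ x ∈ triV v, |f x - a| ≤ b) : |triMean v f - a| ≤ b := by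
  have hpos : 0 < (volume (triV v)).toReal := ENNReal.toReal_pos hv (volume_triV_ne_top v)
  have h1 := norm_setIntegral_le_of_norm_le_const (volume_triV_ne_top v).lt_top
    (f := fun x => f x - a) (C := b) h
  rw [integral_sub hf (integrableOn_const (volume_triV_ne_top v)), setIntegral_const, smul_eq_mul,
    Real.norm_eq_abs] at h1
  have h2 : triMean v f - a = (volume (triV v)).toReal⁻¹ *
      ((∫ z in triV v, f z) - (volume (triV v)).toReal * a) := by
    rw [triMean, mul_sub, inv_mul_cancel_left₀ hpos.ne']
  rw [h2, abs_mul, abs_of_pos (inv_pos.mpr hpos), inv_mul_le_iff₀ hpos, mul_comm _ b]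
  exact h1

section

variable {T : Set Pt} (hT : Convex ℝ T) {e : F2 × F2 → Pt} (he : IsCentred e) {D : ℝ}
  (hD : ∀ ξ, ‖e ξ‖ ≤ D) {f : Pt → ℝ} {g : Pt → Pt →L[ℝ] ℝ} {M : ℝ} (hf : SmoothBound T f g M)
include hT he hD hf

/-- The mean over the centres of the subtriangles of level `n` approximates the integral mean. -/
lemma abs_fhat_zero_sub_triMean_le (hv : volume (triV (scaledTriple e 0 1)) ≠ 0)
    (hfT : IntegrableOn f T) (n : ℕ) : ∀ {c : Pt} {s : ℝ}, s ≠ 0 → VertsIn T e c s →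
    |fhat (ctrFun e c s n f) 0 - triMean (scaledTriple e c s) f| ≤ M * D * |s| / 2 ^ n := by
  induction n with
  | zero =>
    intro c s hs h
    have hsub : triV (scaledTriple e c s) ⊆ T := tri_subset hT h.1 h.2.1 h.2.2
    have hball : triV (scaledTriple e c s) ⊆ Metric.closedBall c (|s| * D) := by
      have hmem : ∀ ξ, c + s • e ξ ∈ Metric.closedBall c (|s| * D) := by
        intro ξ
        rw [mem_closedBall_iff_norm, add_sub_cancel_left, norm_smul, Real.norm_eq_abs]
        exact mul_le_mul_of_nonneg_left (hD ξ) (abs_nonneg s)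
      exact tri_subset (convex_closedBall _ _) (hmem _) (hmem _) (hmem _)
    have hvol : volume (triV (scaledTriple e c s)) ≠ 0 := by
      rw [volume_triV_scaledTriple]
      refine mul_ne_zero ?_ hv
      rw [Ne, ENNReal.ofReal_eq_zero, not_le]
      positivity
    rw [fhat_ctrFun_zero he, abs_sub_comm, pow_zero, div_one]
    refine abs_triMean_sub_le hvol (hfT.mono_set hsub) fun x hx => ?_
    refine (hf.lip c (h.centre_mem hT he) x (hsub hx)).trans ?_
    have := mem_closedBall_iff_norm.mp (hball hx)
    calc _ ≤ M * (|s| * D) := mul_le_mul_of_nonneg_left this hf.nonneg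
      _ = _ := by ring
  | succ n ih =>
    intro c s hs h
    have hsub : triV (scaledTriple e c s) ⊆ T := tri_subset hT h.1 h.2.1 h.2.2
    rw [fhat_ctrFun_succ he, triMean_eq_sum he (hfT.mono_set hsub), ← mul_sub,
      ← Finset.sum_sub_distrib]
    refine abs_quarter_sum_le fun ξ => ?_
    have hfl : flipSign ξ * (s / 2) ≠ 0 := by
      have : flipSign ξ ≠ 0 := fun h0 => by simpa [h0] using abs_flipSign ξ
      exact mul_ne_zero this (div_ne_zero hs two_ne_zero)
    have h1 := ih hfl (h.sub hT he ξ)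
    rw [Pi.zero_apply, walRow_zero_left, one_mul]
    refine h1.trans (le_of_eq ?_)
    rw [abs_mul, abs_flipSign, one_mul, abs_div, abs_two, pow_succ]
    field_simp

end

lemma abs_le_supAbs {T : Set Pt} (hT : IsCompact T) {g : Pt → ℝ} (hg : ContinuousOn g T)
    {x : Pt} (hx : x ∈ T) : |g x| ≤ supAbs T g := by
  obtain ⟨b, hb⟩ := hT.exists_bound_of_continuousOn hg
  have hbdd : BddAbove (Set.range fun y => ⨆ _ : y ∈ T, |g y|) := by
    refine ⟨b, ?_⟩
    rintro _ ⟨y, rfl⟩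
    exact Real.iSup_le (fun hy => hb y hy) ((norm_nonneg _).trans (hb x hx))
  refine le_ciSup_of_le hbdd x ?_
  rw [ciSup_pos hx]

lemma ContDiffOn.pdW {T : Set Pt} (hu : UniqueDiffOn ℝ T) {f : Pt → ℝ} (v : Pt) {m n : ℕ∞}
    (hf : ContDiffOn ℝ n f T) (hmn : m + 1 ≤ n) : ContDiffOn ℝ m (pdW T v f) T :=
  (hf.fderivWithin hu (by exact_mod_cast hmn)).clm_apply contDiffOn_const

lemma abs_apply_le_of_dir {h : Pt →L[ℝ] ℝ} {b : ℝ} (h1 : |h dir1| ≤ b) (h2 : |h dir2| ≤ b)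
    (u : Pt) : |h u| ≤ 2 * b * ‖u‖ := by
  have hu : u = u 0 • dir1 + u 1 • dir2 := by
    ext i; fin_cases i <;> simp [dir1, dir2]
  have k0 : |u 0| ≤ ‖u‖ := PiLp.norm_apply_le u 0
  have k1 : |u 1| ≤ ‖u‖ := PiLp.norm_apply_le u 1
  have hb : 0 ≤ b := (abs_nonneg _).trans h1
  calc |h u| = |u 0 * h dir1 + u 1 * h dir2| := by
        conv_lhs => rw [hu]
        simp
    _ ≤ |u 0| * |h dir1| + |u 1| * |h dir2| := by
        rw [← abs_mul, ← abs_mul]; exact abs_add_le _ _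
    _ ≤ ‖u‖ * b + ‖u‖ * b := by gcongr
    _ = 2 * b * ‖u‖ := by ring

/-- Mixed second partial derivatives agree. -/
lemma pdW_comm {T : Set Pt} (hT : Convex ℝ T) (hi : (interior T).Nonempty) {f : Pt → ℝ}
    (hf : ContDiffOn ℝ 2 f T) (v w : Pt) {x : Pt} (hx : x ∈ T) :
    pdW T v (pdW T w f) x = pdW T w (pdW T v f) x := by
  have hu := uniqueDiffOn_convex hT hi
  have hd : DifferentiableWithinAt ℝ (fderivWithin ℝ f T) T x :=
    (hf.fderivWithin (m := 1) hu (by norm_num)).differentiableOn (by norm_num) x hx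
  have key : ∀ v w, pdW T v (pdW T w f) x = fderivWithin ℝ (fderivWithin ℝ f T) T x v w := by
    intro v w
    change fderivWithin ℝ (fun y => fderivWithin ℝ f T y w) T x v = _
    rw [fderivWithin_clm_apply (hu x hx) hd (differentiableWithinAt_const w)]
    simp
  have hcl : x ∈ closure (interior T) := by
    rw [hT.closure_interior_eq_closure_of_nonempty_interior hi]
    exact subset_closure hx
  rw [key, key]
  exact ((hf x hx).isSymmSndFDerivWithinAt (by simp) hu hcl hx) v w

/-- Functions with finite `C²` norm on a convex body satisfy the quantitative smoothness bounds. -/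
lemma smoothBound_of_contDiffOn {T : Set Pt} (hT : Convex ℝ T) (hc : IsCompact T)
    (hi : (interior T).Nonempty) {f : Pt → ℝ} (hf : ContDiffOn ℝ 2 f T) :
    SmoothBound T f (fderivWithin ℝ f T) (4 * c2Norm T f) := by
  have hu := uniqueDiffOn_convex hT hi
  have hp : ∀ v, ContDiffOn ℝ 1 (pdW T v f) T := fun v =>
    hf.pdW (m := 1) (n := 2) hu v (by norm_num)
  have hpp : ∀ v w, ContinuousOn (pdW T v (pdW T w f)) T := fun v w =>
    ((hp w).pdW (m := 0) (n := 1) hu v (by norm_num)).continuousOn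
  obtain ⟨-, n1, n2, n11, n21, n22⟩ : supAbs T f ≤ c2Norm T f ∧
      supAbs T (pdW T dir1 f) ≤ c2Norm T f ∧ supAbs T (pdW T dir2 f) ≤ c2Norm T f ∧
      supAbs T (pdW T dir1 (pdW T dir1 f)) ≤ c2Norm T f ∧
      supAbs T (pdW T dir2 (pdW T dir1 f)) ≤ c2Norm T f ∧
      supAbs T (pdW T dir2 (pdW T dir2 f)) ≤ c2Norm T f := by
    simp [c2Norm]
  have b1 : ∀ x ∈ T, |fderivWithin ℝ f T x dir1| ≤ c2Norm T f := fun x hx =>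
    (abs_le_supAbs hc (hp dir1).continuousOn hx).trans n1
  have b2 : ∀ x ∈ T, |fderivWithin ℝ f T x dir2| ≤ c2Norm T f := fun x hx =>
    (abs_le_supAbs hc (hp dir2).continuousOn hx).trans n2
  have hN : 0 ≤ c2Norm T f := by
    obtain ⟨x, hx⟩ := hi
    exact (abs_nonneg _).trans (b1 x (interior_subset hx))
  have hgrad : ∀ x ∈ T, ∀ u, |fderivWithin ℝ f T x u| ≤ 2 * c2Norm T f * ‖u‖ := fun x hx =>
    abs_apply_le_of_dir (b1 x hx) (b2 x hx)
  have hlip : ∀ v, (∀ x ∈ T, |pdW T dir1 (pdW T v f) x| ≤ c2Norm T f) →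
      (∀ x ∈ T, |pdW T dir2 (pdW T v f) x| ≤ c2Norm T f) → ∀ x ∈ T, ∀ y ∈ T,
      |fderivWithin ℝ f T y v - fderivWithin ℝ f T x v| ≤ 2 * c2Norm T f * ‖y - x‖ := by
    intro v h1 h2 x hx y hy
    exact hT.norm_image_sub_le_of_norm_fderivWithin_le (𝕜 := ℝ) (f := pdW T v f)
      ((hp v).differentiableOn (by norm_num))
      (fun z hz => ContinuousLinearMap.opNorm_le_bound _ (by positivity)
        (abs_apply_le_of_dir (h1 z hz) (h2 z hz))) hx hy
  have hl1 := hlip dir1 (fun x hx => (abs_le_supAbs hc (hpp _ _) hx).trans n11)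
    (fun x hx => (abs_le_supAbs hc (hpp _ _) hx).trans n21)
  have hl2 := hlip dir2
    (fun x hx => by
      rw [pdW_comm hT hi hf _ _ hx]
      exact (abs_le_supAbs hc (hpp _ _) hx).trans n21)
    (fun x hx => (abs_le_supAbs hc (hpp _ _) hx).trans n22)
  have hgl : ∀ x ∈ T, ∀ y ∈ T, ∀ u, |fderivWithin ℝ f T y u - fderivWithin ℝ f T x u|
      ≤ 4 * c2Norm T f * ‖y - x‖ * ‖u‖ := by
    intro x hx y hy u
    have := abs_apply_le_of_dir (h := fderivWithin ℝ f T y - fderivWithin ℝ f T x)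
      (hl1 x hx y hy) (hl2 x hx y hy) u
    refine this.trans (le_of_eq ?_)
    ring
  have hdf : DifferentiableOn ℝ f T := hf.differentiableOn (by norm_num)
  refine ⟨by positivity, fun x hx u => (hgrad x hx u).trans ?_, hgl, fun x hx y hy => ?_,
    fun x hx y hy => ?_⟩
  · gcongr; norm_num
  · refine (hT.norm_image_sub_le_of_norm_fderivWithin_le (𝕜 := ℝ) (C := 2 * c2Norm T f) hdf
      (fun z hz => ContinuousLinearMap.opNorm_le_bound _ (by positivity) (hgrad z hz))
      hx hy).trans ?_
    gcongr; norm_num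
  · have hseg : segment ℝ x y ⊆ T := hT.segment_subset hx hy
    have := (convex_segment (𝕜 := ℝ) x y).norm_image_sub_le_of_norm_hasFDerivWithin_le'
      (f := f) (f' := fderivWithin ℝ f T) (φ := fderivWithin ℝ f T x)
      (C := 4 * c2Norm T f * ‖y - x‖)
      (fun z hz => ((hdf z (hseg hz)).hasFDerivWithinAt).mono hseg)
      (fun z hz => ?_) (left_mem_segment ℝ x y) (right_mem_segment ℝ x y)
    · rw [Real.norm_eq_abs] at this
      refine this.trans (le_of_eq ?_)
      ring
    · refine ContinuousLinearMap.opNorm_le_bound _ (by positivity) fun u => ?_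
      refine (hgl x hx z (hseg hz) u).trans ?_
      have : ‖z - x‖ ≤ ‖y - x‖ := norm_sub_le_of_mem_segment hz
      gcongr

/-- The displacements of the vertices of a triangle from its centre. -/
def vertexDisp (A B C : Pt) (ξ : F2 × F2) : Pt :=
  if ξ = (1, 0) then A - (3 : ℝ)⁻¹ • (A + B + C)
  else if ξ = (0, 1) then B - (3 : ℝ)⁻¹ • (A + B + C)
  else if ξ = (1, 1) then C - (3 : ℝ)⁻¹ • (A + B + C)
  else 0

lemma isCentred_vertexDisp (A B C : Pt) : IsCentred (vertexDisp A B C) where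
  zero := by simp [vertexDisp]
  sum_eq := by
    simp only [vertexDisp, Prod.mk.injEq, zero_ne_one, one_ne_zero, and_true, and_false, and_self,
      if_true, if_false]
    module

lemma scaledTriple_vertexDisp (A B C : Pt) :
    scaledTriple (vertexDisp A B C) ((3 : ℝ)⁻¹ • (A + B + C)) 1 = (A, B, C) := by
  simp [scaledTriple, vertexDisp]

lemma vertsIn_vertexDisp (A B C : Pt) :
    VertsIn (tri A B C) (vertexDisp A B C) ((3 : ℝ)⁻¹ • (A + B + C)) 1 := by
  have h := scaledTriple_vertexDisp A B C
  simp only [scaledTriple, Prod.mk.injEq] at h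
  obtain ⟨h1, h2, h3⟩ := h
  rw [VertsIn, h1, h2, h3]
  exact ⟨mem_tri_fst A B C, mem_tri_snd A B C, mem_tri_thd A B C⟩

lemma volume_vertexDisp_ne_zero {A B C : Pt} (hT : AffineIndependent ℝ ![A, B, C]) :
    volume (triV (scaledTriple (vertexDisp A B C) 0 1)) ≠ 0 := by
  intro h0
  have h := volume_triV_scaledTriple (vertexDisp A B C) ((3 : ℝ)⁻¹ • (A + B + C)) 1
  rw [h0, mul_zero, scaledTriple_vertexDisp] at h
  exact (Measure.measure_pos_of_nonempty_interior volume (interior_tri_nonempty hT)).ne' h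

lemma one_le_mu1_add_mu1 {n : ℕ} {K : Fin n → F2 × F2} (hK : K ≠ 0) :
    1 ≤ mu1 (fun i => (K i).1) + mu1 (fun i => (K i).2) := by
  obtain ⟨j, hj, -⟩ := exists_eq_vK hK
  rw [vK] at hj
  omega

/-- The quantitative form of the error bound, with `D` bounding the vertex displacements. -/
lemma abs_qmc_sub_mean_le {A B C : Pt} (hT : AffineIndependent ℝ ![A, B, C])
    {Cm : Fin 2 → ℕ → ℕ → F2} (htri : ∀ j : Fin 2, ∀ k l : ℕ, l < k → Cm j k l = 0)
    {m p : ℕ} (hp : ∀ K ∈ dualNet Cm m m, K ≠ 0 →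
      p + 1 ≤ mu1 (fun i => (K i).1) + mu1 (fun i => (K i).2))
    {D : ℝ} (hD0 : 0 ≤ D) (hD : ∀ ξ, ‖vertexDisp A B C ξ‖ ≤ D)
    {f : Pt → ℝ} (hf : ContDiffOn ℝ 2 f (tri A B C)) :
    |((2 : ℝ) ^ m)⁻¹ * ∑ h ∈ Finset.range (2 ^ m), f (seqPt (A, B, C) Cm h) -
        (volume (tri A B C)).toReal⁻¹ * ∫ z in tri A B C, f z| ≤
      4 * c2Norm (tri A B C) f * (2 * D + 2 * D ^ 2) * (4 * m * (m + 1) / 2 ^ p)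
        + 4 * c2Norm (tri A B C) f * D / 2 ^ m := by
  have hS := smoothBound_of_contDiffOn (convex_tri A B C) (isCompact_tri A B C)
    (interior_tri_nonempty hT) hf
  have hfint := hf.continuousOn.integrableOn_compact (μ := volume) (isCompact_tri A B C)
  have he := isCentred_vertexDisp A B C
  have hV := vertsIn_vertexDisp A B C
  have h1 := abs_net_sub_mean_le (convex_tri A B C) he hD hS hD0 Cm hp hV
  have h2 := abs_fhat_zero_sub_triMean_le (convex_tri A B C) he hD hS
    (volume_vertexDisp_ne_zero hT) hfint m one_ne_zero hV
  simp only [ctrFun, scaledTriple_vertexDisp] at h1 h2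
  rw [abs_one, mul_one] at h2
  rw [Finset.sum_congr rfl fun h hh =>
    congrArg f (seqPt_eq (A, B, C) htri (Finset.mem_range.mp hh))]
  exact (abs_sub_le _ _ _).trans (add_le_add h1 h2)

/-- Worst-case error bound `C ‖f‖_{C²(T)} m² / 2^m` for the first `2^m`
points of the QMC rule in a triangle generated by a digital `(t,2)`-sequence with upper
triangular generating matrices. -/
theorem statement2 (A B C : Pt) (hT : AffineIndependent ℝ ![A, B, C]) (t : ℕ)
    (Cm : Fin 2 → ℕ → ℕ → F2)
    (htri : ∀ j : Fin 2, ∀ k l : ℕ, l < k → Cm j k l = 0)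
    (hseq : ∀ m n : ℕ, t < m → m ≤ n → ∀ K : Fin n → F2 × F2, K ≠ 0 →
      (∀ l : ℕ, l < m →
        (∑ i : Fin n, (Cm 0 (i : ℕ) l * (K i).1 + Cm 1 (i : ℕ) l * (K i).2)) = 0) →
      m - t + 1 ≤ mu1 (fun i => (K i).1) + mu1 (fun i => (K i).2)) :
    ∃ Cc : ℝ, 0 < Cc ∧
      ∀ f : Pt → ℝ, ContDiffOn ℝ 2 f (tri A B C) →
        ∀ m : ℕ, 1 ≤ m →
          |((2 : ℝ) ^ m)⁻¹ * ∑ h ∈ Finset.range (2 ^ m), f (seqPt (A, B, C) Cm h) -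
            (volume (tri A B C)).toReal⁻¹ * ∫ z in tri A B C, f z| ≤
          Cc * c2Norm (tri A B C) f * m ^ 2 / 2 ^ m := by
  set D : ℝ := ∑ ξ, ‖vertexDisp A B C ξ‖ + 1
  have hD0 : 0 < D := by positivity
  have hD : ∀ ξ, ‖vertexDisp A B C ξ‖ ≤ D := fun ξ =>
    (Finset.single_le_sum (f := fun ξ => ‖vertexDisp A B C ξ‖) (fun _ _ => norm_nonneg _)
      (Finset.mem_univ ξ)).trans (le_add_of_nonneg_right zero_le_one)
  refine ⟨4 * (2 * D + 2 * D ^ 2) * (8 * 2 ^ t) + 4 * D, by positivity, fun f hf m hm => ?_⟩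
  have hp : ∀ K ∈ dualNet Cm m m, K ≠ 0 →
      m - t + 1 ≤ mu1 (fun i => (K i).1) + mu1 (fun i => (K i).2) := by
    intro K hK hK0
    rcases lt_or_ge t m with htm | htm
    · exact hseq m m htm le_rfl K hK0 hK
    · rw [Nat.sub_eq_zero_of_le htm, zero_add]
      exact one_le_mu1_add_mu1 hK0
  have hN : 0 ≤ 4 * c2Norm (tri A B C) f := (smoothBound_of_contDiffOn (convex_tri A B C)
    (isCompact_tri A B C) (interior_tri_nonempty hT) hf).nonneg
  have hm1 : (1 : ℝ) ≤ m := by exact_mod_cast hm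
  have hw : (4 * m * (m + 1) / 2 ^ (m - t) : ℝ) ≤ 8 * 2 ^ t * m ^ 2 / 2 ^ m := by
    rw [div_le_div_iff₀ (by positivity) (by positivity)]
    have hpow : (2 : ℝ) ^ m ≤ 2 ^ t * 2 ^ (m - t) := by
      rw [← pow_add]
      exact pow_le_pow_right₀ one_le_two (by omega)
    calc (4 * m * (m + 1) * 2 ^ m : ℝ) ≤ 8 * m ^ 2 * (2 ^ t * 2 ^ (m - t)) :=
          mul_le_mul (by nlinarith) hpow (by positivity) (by positivity)
      _ = 8 * 2 ^ t * m ^ 2 * 2 ^ (m - t) := by ring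
  have hlast : 4 * c2Norm (tri A B C) f * D / 2 ^ m
      ≤ 4 * c2Norm (tri A B C) f * D * m ^ 2 / 2 ^ m :=
    div_le_div_of_nonneg_right
      (le_mul_of_one_le_right (mul_nonneg hN hD0.le) (one_le_pow₀ hm1)) (by positivity)
  calc _ ≤ _ := abs_qmc_sub_mean_le hT htri hp hD0.le hD hf
    _ ≤ 4 * c2Norm (tri A B C) f * (2 * D + 2 * D ^ 2) * (8 * 2 ^ t * m ^ 2 / 2 ^ m)
        + 4 * c2Norm (tri A B C) f * D * m ^ 2 / 2 ^ m :=
      add_le_add (mul_le_mul_of_nonneg_left hw (mul_nonneg hN (by positivity))) hlast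
    _ = _ := by ring

end
end

section
/- Let T = △(e(1,0), e(0,1), e(1,1)) with e(1,0)+e(0,1)+e(1,1) = (0,0), and set e(0,0) := (0,0). Then for every X = (ξ_{ij}) ∈ 𝔽₂^{n×2} and every 1 ≤ i ≤ n, the center of the subregion T^{(i)}(X) satisfies φ^{(i)}(X) = ∑_{j=1}^{i} (η_j(X)/2^j)·e(ξ_{j1}, ξ_{j2}). -/
open MeasureTheory

noncomputable section

/-- Passing a zero row flips the sign `η`, and passing any other row keeps it. -/
lemma eta_succ {n : ℕ} (X : Fin n → F2 × F2) (i : Fin n) :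
    eta X ((i : ℕ) + 2) = (if X i = (0, 0) then -1 else 1) * eta X ((i : ℕ) + 1) := by
  unfold eta
  split_ifs with h
  · have : (Finset.univ.filter fun a : Fin n => (a : ℕ) + 1 < (i : ℕ) + 2 ∧ X a = (0, 0)) =
        insert i (Finset.univ.filter fun a : Fin n => (a : ℕ) + 1 < (i : ℕ) + 1 ∧
          X a = (0, 0)) := by
      ext a
      simp only [Finset.mem_filter, Finset.mem_univ, true_and, Finset.mem_insert]
      constructor
      · rintro ⟨hlt, hz⟩
        by_cases hai : a = i
        · exact Or.inl hai
        · have : (a : ℕ) ≠ i := fun hv => hai (Fin.ext hv)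
          exact Or.inr ⟨by omega, hz⟩
      · rintro (rfl | ⟨hlt, hz⟩)
        · exact ⟨by omega, h⟩
        · exact ⟨by omega, hz⟩
    rw [this, Finset.card_insert_of_notMem (by simp), pow_succ, mul_comm]
  · rw [one_mul]
    congr 2
    ext a
    simp only [Finset.mem_filter, Finset.mem_univ, true_and]
    constructor
    · rintro ⟨hlt, hz⟩
      have : (a : ℕ) ≠ i := fun hv => h (Fin.ext hv ▸ hz)
      exact ⟨by omega, hz⟩
    · rintro ⟨hlt, hz⟩
      exact ⟨by omega, hz⟩

/-- One partitioning step applied to a scaled and translated copy of the centred triangle. -/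
lemma subV_scaled (e : F2 × F2 → Pt) (he0 : e (0, 0) = 0)
    (hsum : e (1, 0) + e (0, 1) + e (1, 1) = 0) (c : Pt) (s t : ℝ) (ξ : F2 × F2)
    (ht : t = (if ξ = (0, 0) then -1 else 1) * (s / 2)) :
    subV (c + s • e (1, 0), c + s • e (0, 1), c + s • e (1, 1)) ξ =
      (c + (s / 2) • e ξ + t • e (1, 0), c + (s / 2) • e ξ + t • e (0, 1),
        c + (s / 2) • e ξ + t • e (1, 1)) := by
  have h11 : e (1, 1) = -e (1, 0) - e (0, 1) := by
    rw [eq_sub_iff_add_eq, eq_neg_iff_add_eq_zero, ← hsum]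
    abel
  subst ht
  have hξ : ξ = (0, 0) ∨ ξ = (1, 0) ∨ ξ = (0, 1) ∨ ξ = (1, 1) := by
    revert ξ
    decide
  rcases hξ with rfl | rfl | rfl | rfl <;>
    simp only [subV, Prod.mk.injEq, zero_ne_one, one_ne_zero, and_true, and_false,
      and_self, if_true, if_false, he0, h11] <;>
    refine ⟨?_, ?_, ?_⟩ <;> module

/-- The vertices of `T^{(i)}(X)` form a scaled and translated copy of the centred triangle. -/
lemma vIter_take (e : F2 × F2 → Pt) (he0 : e (0, 0) = 0)
    (hsum : e (1, 0) + e (0, 1) + e (1, 1) = 0)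
    {n : ℕ} (X : Fin n → F2 × F2) (i : ℕ) (hi : i ≤ n) (c : Pt)
    (hc : c = ∑ j ∈ Finset.univ.filter (fun j : Fin n => (j : ℕ) < i),
        (eta X ((j : ℕ) + 1) / 2 ^ ((j : ℕ) + 1)) • e (X j)) :
    vIter (e (1, 0), e (0, 1), e (1, 1)) ((List.ofFn X).take i) =
      (c + (eta X (i + 1) / 2 ^ i) • e (1, 0), c + (eta X (i + 1) / 2 ^ i) • e (0, 1),
        c + (eta X (i + 1) / 2 ^ i) • e (1, 1)) := by
  induction i generalizing c with
  | zero => subst hc; simp [vIter, eta]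
  | succ i ih =>
    have hlt : i < n := hi
    have hfilter : (Finset.univ.filter fun j : Fin n => (j : ℕ) < i + 1) =
        insert ⟨i, hlt⟩ (Finset.univ.filter fun j : Fin n => (j : ℕ) < i) := by
      ext j
      simp only [Finset.mem_filter, Finset.mem_univ, true_and, Finset.mem_insert, Fin.ext_iff]
      omega
    rw [hfilter, Finset.sum_insert (by simp)] at hc
    have htake : (List.ofFn X).take (i + 1) = (List.ofFn X).take i ++ [X ⟨i, hlt⟩] := by
      rw [List.take_add_one]
      simp [hlt]
    have hscale := eta_succ X ⟨i, hlt⟩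
    have hstep : vIter (e (1, 0), e (0, 1), e (1, 1)) ((List.ofFn X).take i ++ [X ⟨i, hlt⟩]) =
        subV (vIter (e (1, 0), e (0, 1), e (1, 1)) ((List.ofFn X).take i)) (X ⟨i, hlt⟩) := by
      simp [vIter]
    rw [htake, hstep, ih hlt.le _ rfl, subV_scaled e he0 hsum _ _ (eta X (i + 1 + 1) / 2 ^ (i + 1)) _
        (by dsimp only at hscale; rw [hscale, pow_succ]; ring)]
    rw [hc, add_comm (_ • e (X _)), pow_succ, div_div]

/-- Lemma 1, part 1. Formula for the centre `φ^{(i)}(X)` of the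
subregion `T^{(i)}(X)` of the centred triangle. -/
theorem statement3 (e : F2 × F2 → Pt) (he0 : e (0, 0) = 0)
    (hsum : e (1, 0) + e (0, 1) + e (1, 1) = 0)
    {n : ℕ} (X : Fin n → F2 × F2) (i : ℕ) (h1 : 1 ≤ i) (h2 : i ≤ n) :
    ctr (e (1, 0), e (0, 1), e (1, 1)) ((List.ofFn X).take i) =
      ∑ j ∈ Finset.univ.filter (fun j : Fin n => (j : ℕ) < i),
        (eta X ((j : ℕ) + 1) / 2 ^ ((j : ℕ) + 1)) • e (X j) := by
  rw [ctr, vIter_take e he0 hsum X i h2 _ rfl]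
  have h11 : e (1, 1) = -e (1, 0) - e (0, 1) := by
    rw [eq_sub_iff_add_eq, eq_neg_iff_add_eq_zero, ← hsum]
    abel
  rw [h11]
  module
end
end

section
/- Let C₁,C₂ ∈ 𝔽₂^{ℕ×ℕ} be the interleaving matrices given by (C₁)_{i,l} = 1 if and only if l = 2i−1 and (C₂)_{i,l} = 1 if and only if l = 2i (all other entries zero). For m ∈ ℕ, let P ⊂ 𝔽₂^{m×2} be the digital net over 𝔽₂ with generating matrices the upper-left m×m submatrices C₁^{m×m}, C₂^{m×m}. Then v(P^⊥) = (m+1)/2 if m is odd, and v(P^⊥) = m/2 + 1 if m is even. -/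
open MeasureTheory

noncomputable section

/-- `vK K` is at least the (1-indexed) position of any nonzero row. -/
theorem succ_le_vK {n : ℕ} (K : Fin n → F2 × F2) {i : Fin n} (hi : K i ≠ 0) :
    (i : ℕ) + 1 ≤ vK K := by
  by_cases h : (K i).1 = 0
  · have h2 : (K i).2 ≠ 0 := fun h2 => hi (Prod.ext h h2)
    exact le_max_of_le_right
      (Finset.le_sup (f := fun i : Fin n => (i : ℕ) + 1) (by simpa using h2))
  · exact le_max_of_le_left
      (Finset.le_sup (f := fun i : Fin n => (i : ℕ) + 1) (by simpa using h))

/-- A bound on the positions of all nonzero rows bounds `vK K`. -/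
theorem vK_le {n : ℕ} (K : Fin n → F2 × F2) {b : ℕ}
    (h : ∀ i : Fin n, K i ≠ 0 → (i : ℕ) + 1 ≤ b) : vK K ≤ b := by
  refine max_le (Finset.sup_le fun i hi => h i fun h0 => ?_)
    (Finset.sup_le fun i hi => h i fun h0 => ?_) <;> simp [h0] at hi

/-- The minimum weight of the dual of the interleaving net, uniformly in the parity of `m`. -/
theorem sInf_vK_interleaving_dual (m : ℕ) (hm : 0 < m) :
    sInf {w : ℕ | ∃ K : Fin m → F2 × F2, K ≠ 0 ∧
      (∀ l : Fin m, (∑ i : Fin m,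
        ((if (l : ℕ) = 2 * (i : ℕ) then (1 : F2) else 0) * (K i).1 +
          (if (l : ℕ) = 2 * (i : ℕ) + 1 then (1 : F2) else 0) * (K i).2)) = 0) ∧
      w = vK K} = m / 2 + 1 := by
  refine IsLeast.csInf_eq ⟨?_, ?_⟩
  · have hlt : m / 2 < m := by omega
    refine ⟨Pi.single ⟨m / 2, hlt⟩ (0, 1), ?_, fun l => ?_, le_antisymm ?_ ?_⟩
    · simp
    · refine Finset.sum_eq_zero fun i _ => ?_
      by_cases hi : i = ⟨m / 2, hlt⟩
      · have : (l : ℕ) ≠ 2 * (m / 2) + 1 := by omega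
        subst hi
        simp [this]
      · simp [hi]
    · exact succ_le_vK _ (i := ⟨m / 2, hlt⟩) (by simp)
    · refine vK_le _ fun i hi => ?_
      have : i = ⟨m / 2, hlt⟩ := by
        by_contra h
        exact hi (Pi.single_eq_of_ne h _)
      simp [this]
  · rintro w ⟨K, hK, hdual, rfl⟩
    obtain ⟨i, hi⟩ := Function.ne_iff.mp hK
    have hmi : m / 2 ≤ i := by
      by_contra! h
      refine hi (Prod.ext ?_ ?_)
      · have h1 := hdual ⟨2 * i, by omega⟩
        rw [Finset.sum_eq_single i] at h1
        · simpa using h1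
        · intro j _ hj
          have h2 : (i : ℕ) ≠ j := fun e => hj (Fin.ext e.symm)
          have h3 : 2 * (i : ℕ) ≠ 2 * j + 1 := by omega
          simp [h2, h3]
        · simp
      · have h1 := hdual ⟨2 * i + 1, by omega⟩
        rw [Finset.sum_eq_single i] at h1
        · simpa using h1
        · intro j _ hj
          have h2 : (i : ℕ) ≠ j := fun e => hj (Fin.ext e.symm)
          have h3 : 2 * (i : ℕ) + 1 ≠ 2 * j := by omega
          simp [h2, h3]
        · simp
    exact (Nat.succ_le_succ hmi).trans (succ_le_vK K hi)

/-- Exact minimum weight `v(P^⊥)` for the digital net with the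
interleaving generating matrices (the Basu–Owen construction): `(m+1)/2` for odd `m`
and `m/2 + 1` for even `m`. -/
theorem statement6 (m : ℕ) (hm : 0 < m) :
    (Odd m →
      sInf {w : ℕ | ∃ K : Fin m → F2 × F2, K ≠ 0 ∧
        (∀ l : Fin m, (∑ i : Fin m,
          ((if (l : ℕ) = 2 * (i : ℕ) then (1 : F2) else 0) * (K i).1 +
            (if (l : ℕ) = 2 * (i : ℕ) + 1 then (1 : F2) else 0) * (K i).2)) = 0) ∧
        w = vK K} = (m + 1) / 2) ∧
    (Even m →
      sInf {w : ℕ | ∃ K : Fin m → F2 × F2, K ≠ 0 ∧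
        (∀ l : Fin m, (∑ i : Fin m,
          ((if (l : ℕ) = 2 * (i : ℕ) then (1 : F2) else 0) * (K i).1 +
            (if (l : ℕ) = 2 * (i : ℕ) + 1 then (1 : F2) else 0) * (K i).2)) = 0) ∧
        w = vK K} = m / 2 + 1) := by
  rw [sInf_vK_interleaving_dual m hm]
  refine ⟨?_, fun _ => rfl⟩
  rintro ⟨k, rfl⟩
  omega
end
end

section
/- Let C₁,C₂ ∈ 𝔽₂^{ℕ×ℕ} be the interleaving matrices given by (C₁)_{i,l} = 1 if and only if l = 2i−1 and (C₂)_{i,l} = 1 if and only if l = 2i (all other entries zero). For every m ∈ ℕ, the digital net P ⊂ 𝔽₂^{m×2} with generating matrices the upper-left m×m submatrices C₁^{m×m}, C₂^{m×m} is a digital (⌈m/2⌉, m, 2)-net over 𝔽₂, i.e. μ₁(P^⊥) ≥ m − ⌈m/2⌉ + 1. -/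
open MeasureTheory

noncomputable section

/-- The weight of a column bounds the position of each of its nonzero entries. -/
theorem succ_le_mu1 {n : ℕ} {k : Fin n → F2} {i : Fin n} (h : k i ≠ 0) :
    (i : ℕ) + 1 ≤ mu1 k :=
  Finset.le_sup (f := fun i : Fin n => (i : ℕ) + 1) (by simpa using h)

/-- The transposed interleaving matrices recover the entries of the first column of `K` at even
positions. -/
theorem interleave_sum_even {m : ℕ} (K : Fin m → F2 × F2) (i : Fin m) :
    (∑ j : Fin m, ((if 2 * (i : ℕ) = 2 * (j : ℕ) then (1 : F2) else 0) * (K j).1 +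
      (if 2 * (i : ℕ) = 2 * (j : ℕ) + 1 then (1 : F2) else 0) * (K j).2)) = (K i).1 := by
  rw [Finset.sum_eq_single i]
  · simp
  · intro j _ hj
    have h1 : 2 * (i : ℕ) ≠ 2 * (j : ℕ) := fun h => hj (Fin.ext (by omega))
    have h2 : 2 * (i : ℕ) ≠ 2 * (j : ℕ) + 1 := by omega
    rw [if_neg h1, if_neg h2]
    simp
  · simp

/-- The transposed interleaving matrices recover the entries of the second column of `K` at odd
positions. -/
theorem interleave_sum_odd {m : ℕ} (K : Fin m → F2 × F2) (i : Fin m) :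
    (∑ j : Fin m, ((if 2 * (i : ℕ) + 1 = 2 * (j : ℕ) then (1 : F2) else 0) * (K j).1 +
      (if 2 * (i : ℕ) + 1 = 2 * (j : ℕ) + 1 then (1 : F2) else 0) * (K j).2)) = (K i).2 := by
  rw [Finset.sum_eq_single i]
  · simp
  · intro j _ hj
    have h1 : 2 * (i : ℕ) + 1 ≠ 2 * (j : ℕ) := by omega
    have h2 : 2 * (i : ℕ) + 1 ≠ 2 * (j : ℕ) + 1 := fun h => hj (Fin.ext (by omega))
    rw [if_neg h1, if_neg h2]
    simp
  · simp

/-- The digital net with the interleaving generating matrices is a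
digital `(⌈m/2⌉, m, 2)`-net over `𝔽₂`: every nonzero dual element `K` satisfies
`μ₁(K) ≥ m - ⌈m/2⌉ + 1`. -/
theorem statement7 (m : ℕ) (hm : 0 < m) :
    ∀ K : Fin m → F2 × F2, K ≠ 0 →
      (∀ l : Fin m, (∑ i : Fin m,
        ((if (l : ℕ) = 2 * (i : ℕ) then (1 : F2) else 0) * (K i).1 +
          (if (l : ℕ) = 2 * (i : ℕ) + 1 then (1 : F2) else 0) * (K i).2)) = 0) →
      m - (m + 1) / 2 + 1 ≤ mu1 (fun i => (K i).1) + mu1 (fun i => (K i).2) := by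
  intro K hK h
  obtain ⟨i, hi⟩ := Function.ne_iff.mp hK
  by_cases h1 : (K i).1 = 0
  · have h2 : (K i).2 ≠ 0 := fun h2 => hi (Prod.ext h1 h2)
    have hle : m ≤ 2 * (i : ℕ) + 1 := by
      by_contra! hlt
      exact h2 ((interleave_sum_odd K i).symm.trans (h ⟨2 * (i : ℕ) + 1, hlt⟩))
    have := succ_le_mu1 (k := fun i => (K i).2) h2
    omega
  · have hle : m ≤ 2 * (i : ℕ) := by
      by_contra! hlt
      exact h1 ((interleave_sum_even K i).symm.trans (h ⟨2 * (i : ℕ), hlt⟩))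
    have := succ_le_mu1 (k := fun i => (K i).1) h1
    omega
end
end

section
/- Let T = △(e(1,0), e(0,1), e(1,1)) with e(1,0)+e(0,1)+e(1,1) = (0,0) and e(0,0) := (0,0). Let κ ∈ 𝔽₂²∖{(0,0)}, X = (ξ_i)_{i=1}^n ∈ 𝔽₂^{n×2} with rows ξ_i, and 1 ≤ i ≤ n with ξ_i ∈ {(0,0), κ}. Then T^{(n)}(X ⊕_i κ) = 2·φ^{(i−1)}(X) + (η_i(X)/2^i)·τ(κ, ξ_i) − T^{(n)}(X), i.e. T^{(n)}(X ⊕_i κ) = {2·φ^{(i−1)}(X) + (η_i(X)/2^i)·τ(κ, ξ_i) − y : y ∈ T^{(n)}(X)} (with φ^{(0)}(X) := (0,0)). -/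
open MeasureTheory

noncomputable section

/-- The triple of vertices obtained from `(e (1, 0), e (0, 1), e (1, 1))` by scaling by `s`
and translating by `c`. -/
def homTriple (e : F2 × F2 → Pt) (c : Pt) (s : ℝ) : Pt × Pt × Pt :=
  (c + s • e (1, 0), c + s • e (0, 1), c + s • e (1, 1))

/-- The point reflection `y ↦ p - y` acting on triples of vertices. -/
def reflTriple (p : Pt) (v : Pt × Pt × Pt) : Pt × Pt × Pt :=
  (p - v.1, p - v.2.1, p - v.2.2)

theorem F2_prod_cases (ξ : F2 × F2) :
    ξ = (0, 0) ∨ ξ = (1, 0) ∨ ξ = (0, 1) ∨ ξ = (1, 1) := by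
  revert ξ; decide

theorem F2_prod_add_self (κ : F2 × F2) : κ + κ = (0, 0) := by
  revert κ; decide

theorem subV_homTriple (e : F2 × F2 → Pt) (he0 : e (0, 0) = 0)
    (hsum : e (1, 0) + e (0, 1) + e (1, 1) = 0) (c : Pt) (s : ℝ) (ξ : F2 × F2) :
    subV (homTriple e c s) ξ =
      homTriple e (c + (s / 2) • e ξ) (if ξ = (0, 0) then -(s / 2) else s / 2) := by
  have h11 : e (1, 1) = -(e (1, 0) + e (0, 1)) := (neg_eq_of_add_eq_zero_right hsum).symm
  rcases F2_prod_cases ξ with rfl | rfl | rfl | rfl <;>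
    simp [subV, homTriple, he0, h11] <;>
    (try refine ⟨?_, ?_, ?_⟩) <;> module

theorem subV_reflTriple (p : Pt) (v : Pt × Pt × Pt) (ξ : F2 × F2) :
    subV (reflTriple p v) ξ = reflTriple p (subV v ξ) := by
  unfold subV reflTriple
  split_ifs <;> refine Prod.ext ?_ (Prod.ext ?_ ?_) <;> dsimp only <;> module

theorem vIter_append_cons (v : Pt × Pt × Pt) (l l' : List (F2 × F2)) (ξ : F2 × F2) :
    vIter v (l ++ ξ :: l') = vIter (subV (vIter v l) ξ) l' := by
  simp [vIter]

theorem vIter_reflTriple (p : Pt) (v : Pt × Pt × Pt) (l : List (F2 × F2)) :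
    vIter (reflTriple p v) l = reflTriple p (vIter v l) := by
  induction l generalizing v with
  | nil => rfl
  | cons ξ l ih => exact (congrArg (vIter · l) (subV_reflTriple p v ξ)).trans (ih _)

theorem tri_reflTriple (p : Pt) (v : Pt × Pt × Pt) :
    tri (reflTriple p v).1 (reflTriple p v).2.1 (reflTriple p v).2.2 =
      (fun y => p - y) '' tri v.1 v.2.1 v.2.2 := by
  have key (w1 w2 w3 : ℝ) (h : w1 + w2 + w3 = 1) :
      p - (w1 • v.1 + w2 • v.2.1 + w3 • v.2.2) =
        w1 • (p - v.1) + w2 • (p - v.2.1) + w3 • (p - v.2.2) := by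
    obtain rfl : w3 = 1 - w1 - w2 := by linarith
    module
  ext x
  constructor
  · rintro ⟨w1, w2, w3, h1, h2, h3, h, rfl⟩
    exact ⟨_, ⟨w1, w2, w3, h1, h2, h3, h, rfl⟩, key w1 w2 w3 h⟩
  · rintro ⟨_, ⟨w1, w2, w3, h1, h2, h3, h, rfl⟩, rfl⟩
    exact ⟨w1, w2, w3, h1, h2, h3, h, key w1 w2 w3 h⟩

theorem eta_one {n : ℕ} (X : Fin n → F2 × F2) : eta X 1 = 1 := by
  simp [eta]

theorem eta_succ_succ {n : ℕ} (X : Fin n → F2 × F2) (i : Fin n) :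
    eta X ((i : ℕ) + 1 + 1) =
      if X i = (0, 0) then -eta X ((i : ℕ) + 1) else eta X ((i : ℕ) + 1) := by
  unfold eta
  split_ifs with h
  · have hins : (Finset.univ.filter fun a : Fin n => (a : ℕ) + 1 < (i : ℕ) + 1 + 1 ∧ X a = (0, 0))
        = insert i
          (Finset.univ.filter fun a : Fin n => (a : ℕ) + 1 < (i : ℕ) + 1 ∧ X a = (0, 0)) := by
      ext a
      simp only [Finset.mem_filter, Finset.mem_univ, true_and, Finset.mem_insert]
      constructor
      · rintro ⟨ha, hX⟩
        rcases eq_or_ne a i with rfl | hne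
        · exact Or.inl rfl
        · exact Or.inr ⟨by have := Fin.val_ne_of_ne hne; omega, hX⟩
      · rintro (rfl | ⟨ha, hX⟩)
        · exact ⟨by omega, h⟩
        · exact ⟨by omega, hX⟩
    rw [hins, Finset.card_insert_of_notMem (by simp), pow_succ, mul_neg_one]
  · congr 2
    ext a
    simp only [Finset.mem_filter, Finset.mem_univ, true_and, and_congr_left_iff]
    intro hX
    have : (a : ℕ) ≠ i := fun hai => h (Fin.ext hai ▸ hX)
    omega

theorem vIter_take_ofFn (e : F2 × F2 → Pt) (he0 : e (0, 0) = 0)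
    (hsum : e (1, 0) + e (0, 1) + e (1, 1) = 0) {n : ℕ} (X : Fin n → F2 × F2) {m : ℕ}
    (hm : m ≤ n) :
    ∃ c, vIter (e (1, 0), e (0, 1), e (1, 1)) ((List.ofFn X).take m) =
      homTriple e c (eta X (m + 1) / 2 ^ m) := by
  induction m with
  | zero => exact ⟨0, by simp [vIter, homTriple, eta_one]⟩
  | succ m ih =>
    obtain ⟨c, hc⟩ := ih (by omega)
    refine ⟨c + (eta X (m + 1) / 2 ^ m / 2) • e (X ⟨m, hm⟩), ?_⟩
    have htake : (List.ofFn X).take (m + 1) = (List.ofFn X).take m ++ [X ⟨m, hm⟩] := by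
      rw [List.take_succ_eq_append_getElem (by simpa using hm), List.getElem_ofFn]
    have heta := eta_succ_succ X ⟨m, hm⟩
    dsimp only at heta
    rw [htake, vIter_append_cons, hc, vIter, List.foldl_nil, subV_homTriple e he0 hsum, heta, pow_succ]
    congr 1
    split_ifs <;> ring

theorem ctr_eq_of_vIter_eq_homTriple (e : F2 × F2 → Pt)
    (hsum : e (1, 0) + e (0, 1) + e (1, 1) = 0) {v : Pt × Pt × Pt} {l : List (F2 × F2)}
    {c : Pt} {s : ℝ} (h : vIter v l = homTriple e c s) : ctr v l = c := by
  have h11 : e (1, 1) = -(e (1, 0) + e (0, 1)) := (neg_eq_of_add_eq_zero_right hsum).symm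
  rw [ctr, h, homTriple]
  dsimp only
  rw [h11]
  module

/-- The two subtriangles with labels `ξ ∈ {(0, 0), κ}` and `ξ + κ` are point reflections
of each other. -/
theorem subV_add_eq_reflTriple (e : F2 × F2 → Pt) (he0 : e (0, 0) = 0)
    (hsum : e (1, 0) + e (0, 1) + e (1, 1) = 0) (c : Pt) (s : ℝ) {κ ξ : F2 × F2}
    (hκ : κ ≠ (0, 0)) (hξ : ξ = (0, 0) ∨ ξ = κ) :
    subV (homTriple e c s) (ξ + κ) =
      reflTriple ((2 : ℝ) • c + (s / 2) • tau e κ ξ) (subV (homTriple e c s) ξ) := by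
  have hadd : κ + (0, 0) = κ := add_zero κ
  have hadd' : (0, 0) + κ = κ := zero_add κ
  rw [subV_homTriple e he0 hsum, subV_homTriple e he0 hsum]
  rcases hξ with rfl | rfl
  · simp only [tau, ne_eq, not_true_eq_false, false_and, if_false, if_true, hadd, hadd',
      if_neg hκ, he0, homTriple, reflTriple]
    refine Prod.ext ?_ (Prod.ext ?_ ?_) <;> dsimp only <;> module
  · simp only [tau, ne_eq, not_true_eq_false, and_false, if_false, if_true,
      F2_prod_add_self, if_neg hκ, he0, homTriple, reflTriple]
    refine Prod.ext ?_ (Prod.ext ?_ ?_) <;> dsimp only <;> module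

theorem ofFn_update_eq_append {α : Type*} {n : ℕ} (X : Fin n → α) (i : Fin n) (a : α) :
    List.ofFn (Function.update X i a) =
      (List.ofFn X).take i ++ a :: (List.ofFn X).drop ((i : ℕ) + 1) := by
  have hi : (i : ℕ) < (List.ofFn X).length := by simp
  have h : List.ofFn (Function.update X i a) = (List.ofFn X).set i a := by
    apply List.ext_getElem <;> simp [List.getElem_set, Function.update_apply, Fin.ext_iff, eq_comm]
  rw [h, List.set_eq_take_append_cons_drop, if_pos hi]

/-- Lemma 5, part 2. If the `i`-th row of `X` is `0` or `κ`, then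
`T^{(n)}(X ⊕_i κ)` is the reflection `2 φ^{(i-1)}(X) + (η_i(X)/2^i) τ(κ, ξ_i) - T^{(n)}(X)`.
(Here `i : Fin n` is the 0-indexed row, corresponding to the paper's index `i+1`, so the
paper's `φ^{(i-1)}` is the centre after the first `(i : ℕ)` rows.) -/
theorem statement13 (e : F2 × F2 → Pt) (he0 : e (0, 0) = 0)
    (hsum : e (1, 0) + e (0, 1) + e (1, 1) = 0)
    {n : ℕ} (κ : F2 × F2) (hκ : κ ≠ (0, 0)) (X : Fin n → F2 × F2) (i : Fin n)
    (hξ : X i = (0, 0) ∨ X i = κ) :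
    subTri (e (1, 0), e (0, 1), e (1, 1)) (List.ofFn (Function.update X i (X i + κ))) =
      (fun y => (2 : ℝ) • ctr (e (1, 0), e (0, 1), e (1, 1)) ((List.ofFn X).take (i : ℕ)) +
          (eta X ((i : ℕ) + 1) / 2 ^ ((i : ℕ) + 1)) • tau e κ (X i) - y) ''
        subTri (e (1, 0), e (0, 1), e (1, 1)) (List.ofFn X) := by
  obtain ⟨c, hc⟩ := vIter_take_ofFn e he0 hsum X i.isLt.le
  have hsub (a : F2 × F2) := vIter_append_cons (e (1, 0), e (0, 1), e (1, 1))
    ((List.ofFn X).take i) ((List.ofFn X).drop ((i : ℕ) + 1)) a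
  have hX := ofFn_update_eq_append X i (X i)
  rw [Function.update_eq_self] at hX
  have hL : vIter (e (1, 0), e (0, 1), e (1, 1)) (List.ofFn (Function.update X i (X i + κ))) =
      reflTriple ((2 : ℝ) • c + (eta X ((i : ℕ) + 1) / 2 ^ ((i : ℕ) + 1)) • tau e κ (X i))
        (vIter (e (1, 0), e (0, 1), e (1, 1)) (List.ofFn X)) := by
    rw [ofFn_update_eq_append, hsub, congrArg (vIter _) hX, hsub, hc,
      subV_add_eq_reflTriple e he0 hsum c _ hκ hξ, vIter_reflTriple, pow_succ, div_div]
  rw [ctr_eq_of_vIter_eq_homTriple e hsum hc, subTri, subTri, hL, tri_reflTriple]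
end
end
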